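/- Assume k < n+1 and 1 ≤ d ≤ k. Let id_Y := (2 < 3 < ⋯ < k+1) ∈ W^P and let A_Y(d) be the set of u ∈ W^P ∩ W^odd with u(1) ≠ 1 such that there exists a chain of degree d from id_Y W_P to u W_P in the moment graph of IG(k,2n+1). Then A_Y(d) has a maximal element with respect to the Bruhat order, and this maximal element is the minimal length representative of id_Y ·_k O^∘(d) W_P, which equals (d+2 < d+3 < ⋯ < k+1 < \overline{d+1} < ⋯ < \overline{3} < \overline{2}) if 1 ≤ d < k, and (\overline{k+1} < \overline{k} < ⋯ < \overline{3} < \overline{2}) if d = k. -/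

import Mathlib

/-!
Common framework: the Weyl group of type `C_{m+1}` realized as signed permutations
of `Fin (2*m+2)` (values 0-indexed: the paper's 1-indexed value `a ∈ {1, …, 2m+2}`
corresponds to `a-1`, and the paper's `bar a = 2m+3-a` corresponds to `2m+2-a`).
For the odd symplectic Grassmannian `IG(k, 2n+1)` one takes `m = n`;
the smaller group `W_{2n}` of type `C_n` corresponds to `m = n-1`.
-/

namespace OddSymplectic

open Equiv

noncomputable section

/-- The element of `Fin (2*m+2)` with (0-indexed) value `i`. -/
def fn (m i : ℕ) : Fin (2*m+2) := ⟨i % (2*m+2), Nat.mod_lt _ (by omega)⟩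

/-- The bar involution on values. -/
def bar (m : ℕ) (j : Fin (2*m+2)) : Fin (2*m+2) := ⟨2*m+1 - (j:ℕ), by omega⟩

def barPerm (m : ℕ) : Equiv.Perm (Fin (2*m+2)) :=
  Function.Involutive.toPerm (bar m) (fun j => by
    have hj := j.isLt
    apply Fin.ext
    simp [bar]
    omega)

/-- The Weyl group of type `C_{m+1}`: the permutations of `Fin (2*m+2)` commuting with
the bar involution (signed permutations). -/
def Weyl (m : ℕ) : Subgroup (Equiv.Perm (Fin (2*m+2))) :=
  Subgroup.centralizer {barPerm m}

/-- The simple reflection `s_i`, `1 ≤ i ≤ m+1`. -/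
def sRefl (m i : ℕ) : Equiv.Perm (Fin (2*m+2)) :=
  if i ≤ m then
    Equiv.swap (fn m (i-1)) (fn m i) * Equiv.swap (fn m (2*m+2-i)) (fn m (2*m+1-i))
  else
    Equiv.swap (fn m m) (fn m (m+1))

/-- Coxeter length: the minimal length of an expression as a product of simple reflections. -/
def len (m : ℕ) (w : Equiv.Perm (Fin (2*m+2))) : ℕ :=
  sInf {r | ∃ l : List ℕ, l.length = r ∧ (∀ i ∈ l, 1 ≤ i ∧ i ≤ m+1) ∧
    (l.map (sRefl m)).prod = w}

/-- The set of reflections. -/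
def reflections (m : ℕ) : Set (Equiv.Perm (Fin (2*m+2))) :=
  {t | ∃ u ∈ Weyl m, ∃ i, 1 ≤ i ∧ i ≤ m+1 ∧ t = u * sRefl m i * u⁻¹}

/-- The Bruhat order. -/
def bruhatLE (m : ℕ) (u w : Equiv.Perm (Fin (2*m+2))) : Prop :=
  Relation.ReflTransGen (fun a b => ∃ t ∈ reflections m, b = a * t ∧ len m a < len m b) u w

/-- The parabolic subgroup `W_P` generated by the simple reflections `s_i`, `i ≠ kk`. -/
def WP (m kk : ℕ) : Subgroup (Equiv.Perm (Fin (2*m+2))) :=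
  Subgroup.closure {x | ∃ i, 1 ≤ i ∧ i ≤ m+1 ∧ i ≠ kk ∧ x = sRefl m i}

/-- `x W_P = y W_P`. -/
def cosetEq (m kk : ℕ) (x y : Equiv.Perm (Fin (2*m+2))) : Prop := x⁻¹ * y ∈ WP m kk

/-- `w ∈ W^P`: `w` is a minimal length representative of its coset `w W_P`. -/
def isMinRep (m kk : ℕ) (w : Equiv.Perm (Fin (2*m+2))) : Prop :=
  w ∈ Weyl m ∧ ∀ v ∈ WP m kk, len m w ≤ len m (w * v)

/-- `w ∈ W^{odd}`: `w(j) ≠ bar 1` for all `1 ≤ j ≤ m+1` (1-indexed positions). -/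
def isOdd (m : ℕ) (w : Equiv.Perm (Fin (2*m+2))) : Prop :=
  ∀ j : Fin (2*m+2), (j:ℕ) ≤ m → w j ≠ fn m (2*m+1)

/-- `w ∈ W°`: odd symplectic permutations with `w(j) ≠ 1` for `1 ≤ j ≤ kk`. -/
def isOpen (m kk : ℕ) (w : Equiv.Perm (Fin (2*m+2))) : Prop :=
  isOdd m w ∧ ∀ j : Fin (2*m+2), (j:ℕ) < kk → w j ≠ fn m 0

/-- `φ(u)`: the number of barred entries among the first `kk` values of `u`. -/
def phi (m kk : ℕ) (u : Equiv.Perm (Fin (2*m+2))) : ℕ :=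
  (Finset.univ.filter (fun j : Fin (2*m+2) => (j:ℕ) < kk ∧ m+1 ≤ ((u j : ℕ)))).card

/-- The set of values of `w` on the first `kk` positions. -/
def valSet (m kk : ℕ) (w : Equiv.Perm (Fin (2*m+2))) : Finset (Fin (2*m+2)) :=
  (Finset.univ.filter (fun j : Fin (2*m+2) => (j:ℕ) < kk)).image w

/-- The (1-indexed) absolute value `|x|` of a signed entry. -/
def absVal (m : ℕ) (x : Fin (2*m+2)) : ℕ :=
  if (x:ℕ) ≤ m then (x:ℕ)+1 else 2*m+2-(x:ℕ)

/-! ### Hecke products -/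

def hStep (m : ℕ) (w : Equiv.Perm (Fin (2*m+2))) (i : ℕ) : Equiv.Perm (Fin (2*m+2)) :=
  if len m w < len m (w * sRefl m i) then w * sRefl m i else w

/-- Hecke product of `w` with the word `l` of simple reflections. -/
def hWord (m : ℕ) (w : Equiv.Perm (Fin (2*m+2))) (l : List ℕ) : Equiv.Perm (Fin (2*m+2)) :=
  l.foldl (hStep m) w

def hStepK (m kk : ℕ) (w : Equiv.Perm (Fin (2*m+2))) (i : ℕ) : Equiv.Perm (Fin (2*m+2)) :=
  if len m w < len m (w * sRefl m i) ∨ i = kk then w * sRefl m i else w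

/-- Modified Hecke product `·_k` of `w` with the word `l`. -/
def hWordK (m kk : ℕ) (w : Equiv.Perm (Fin (2*m+2))) (l : List ℕ) : Equiv.Perm (Fin (2*m+2)) :=
  l.foldl (hStepK m kk) w

/-- The list `[a, a+1, …, b]`. -/
def ascList (a b : ℕ) : List ℕ := List.range' a (b+1-a)

/-- The word `s_1 s_2 ⋯ s_{m+1} ⋯ s_2 s_1` for `O^∘(1)`. -/
def wordOcirc1 (m : ℕ) : List ℕ := ascList 1 (m+1) ++ (ascList 1 m).reverse

/-- The word `s_1 ⋯ s_{kk-1} s_{kk+1} ⋯ s_{m+1} ⋯ s_2 s_1` for `O_Y(1)`. -/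
def wordOY1 (m kk : ℕ) : List ℕ :=
  ascList 1 (kk-1) ++ ascList (kk+1) (m+1) ++ (ascList 1 m).reverse

/-- The word `s_2 ⋯ s_{m+1} ⋯ s_2` for `O_Z(1)`. -/
def wordOZ1 (m : ℕ) : List ℕ := ascList 2 (m+1) ++ (ascList 2 m).reverse

def wordOcirc (m d : ℕ) : List ℕ := (List.replicate d (wordOcirc1 m)).flatten
def wordOZ (m d : ℕ) : List ℕ := (List.replicate d (wordOZ1 m)).flatten

/-- `w ·_k O^∘(d)`. -/
def mulOcirc (m kk : ℕ) (w : Equiv.Perm (Fin (2*m+2))) (d : ℕ) : Equiv.Perm (Fin (2*m+2)) :=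
  hWordK m kk w (wordOcirc m d)

/-- `w · O_Z(d)`. -/
def mulOZ (m : ℕ) (w : Equiv.Perm (Fin (2*m+2))) (d : ℕ) : Equiv.Perm (Fin (2*m+2)) :=
  hWord m w (wordOZ m d)

/-- `w · O_Y(1)`. -/
def mulOY1 (m kk : ℕ) (w : Equiv.Perm (Fin (2*m+2))) : Equiv.Perm (Fin (2*m+2)) :=
  hWord m w (wordOY1 m kk)

/-- `w · O_Y(d) = (w · O_Y(1)) ·_k O^∘(d-1)`. -/
def mulOY (m kk : ℕ) (w : Equiv.Perm (Fin (2*m+2))) (d : ℕ) : Equiv.Perm (Fin (2*m+2)) :=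
  mulOcirc m kk (mulOY1 m kk w) (d-1)

/-! ### Positive roots of type `C_{m+1}` -/

/-- Positive roots of type `C_{m+1}` (1-indexed `i < j ≤ m+1`). -/
inductive PosRoot : Type
  | tm (i j : ℕ)   -- `t_i - t_j`
  | tp (i j : ℕ)   -- `t_i + t_j`
  | lg (i : ℕ)     -- `2 t_i`

def PosRoot.valid (m : ℕ) : PosRoot → Prop
  | .tm i j => 1 ≤ i ∧ i < j ∧ j ≤ m+1
  | .tp i j => 1 ≤ i ∧ i < j ∧ j ≤ m+1
  | .lg i => 1 ≤ i ∧ i ≤ m+1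

/-- The reflection `s_α`. -/
def PosRoot.refl (m : ℕ) : PosRoot → Equiv.Perm (Fin (2*m+2))
  | .tm i j => Equiv.swap (fn m (i-1)) (fn m (j-1)) *
      Equiv.swap (fn m (2*m+2-i)) (fn m (2*m+2-j))
  | .tp i j => Equiv.swap (fn m (i-1)) (fn m (2*m+2-j)) *
      Equiv.swap (fn m (j-1)) (fn m (2*m+2-i))
  | .lg i => Equiv.swap (fn m (i-1)) (fn m (2*m+2-i))

/-- The coefficient of the simple root `α_kk` in the expansion of `α` in simple roots. -/
def PosRoot.rootCoeff (m kk : ℕ) : PosRoot → ℕ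
  | .tm i j => if i ≤ kk ∧ kk < j then 1 else 0
  | .tp i j => if i ≤ kk ∧ kk < j then 1 else if j ≤ kk ∧ kk ≤ m then 2
      else if j ≤ kk then 1 else 0
  | .lg i => if i ≤ kk ∧ kk ≤ m then 2 else if i ≤ kk then 1 else 0

/-- The coefficient of the simple coroot `α_kk^∨` in the expansion of `α^∨` in simple
coroots: the degree of the corresponding edge of the moment graph. -/
def PosRoot.corootCoeff (kk : ℕ) : PosRoot → ℕ
  | .tm i j => if i ≤ kk ∧ kk < j then 1 else 0
  | .tp i j => if i ≤ kk ∧ kk < j then 1 else if j ≤ kk then 2 else 0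
  | .lg i => if i ≤ kk then 1 else 0

/-- `α ∈ R_1^+`. -/
def PosRoot.inR1 (m kk : ℕ) : PosRoot → Bool
  | .tm i j => decide (1 ≤ i ∧ i ≤ kk ∧ kk < j ∧ j ≤ m+1)
  | .tp i j => decide (1 ≤ i ∧ i ≤ kk ∧ kk < j ∧ j ≤ m+1)
  | .lg i => decide (1 ≤ i ∧ i ≤ kk)

/-- `α ∈ R_2^+`. -/
def PosRoot.inR2 (kk : ℕ) : PosRoot → Bool
  | .tp i j => decide (1 ≤ i ∧ i < j ∧ j ≤ kk)
  | _ => false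

/-- Chains in the moment graph of `IG(kk, 2m+2)`, recorded with their list of roots:
each step goes from the vertex `u W_P` to the vertex with minimal length representative
`v`, where `v W_P = u s_α W_P` and `α ∈ R^+ \ R_P^+`. -/
inductive Chain (m kk : ℕ) :
    Equiv.Perm (Fin (2*m+2)) → Equiv.Perm (Fin (2*m+2)) → List PosRoot → Prop
  | nil (u : Equiv.Perm (Fin (2*m+2))) : Chain m kk u u []
  | cons {u w : Equiv.Perm (Fin (2*m+2))} {l : List PosRoot}
      (a : PosRoot) (v : Equiv.Perm (Fin (2*m+2))) :
      a.valid m → a.rootCoeff m kk ≠ 0 → isMinRep m kk v →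
      cosetEq m kk v (u * a.refl m) → Chain m kk v w l → Chain m kk u w (a :: l)

/-- The degree of a chain: the sum of the degrees of its edges. -/
def chainDeg (kk : ℕ) (l : List PosRoot) : ℕ := (l.map (PosRoot.corootCoeff kk)).sum

/-- Chains of a given total degree in the moment graph of `IG(kk, 2m+1)`
(the full subgraph of the moment graph of `IG(kk, 2m+2)` on `W^P ∩ W^{odd}`). -/
inductive ChainO (m kk : ℕ) :
    Equiv.Perm (Fin (2*m+2)) → Equiv.Perm (Fin (2*m+2)) → ℕ → Prop
  | nil (u : Equiv.Perm (Fin (2*m+2))) : ChainO m kk u u 0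
  | cons {u w : Equiv.Perm (Fin (2*m+2))} {d : ℕ}
      (a : PosRoot) (v : Equiv.Perm (Fin (2*m+2))) :
      a.valid m → a.rootCoeff m kk ≠ 0 → isMinRep m kk v → isOdd m v →
      cosetEq m kk v (u * a.refl m) → ChainO m kk v w d →
      ChainO m kk u w (a.corootCoeff kk + d)

/-! ### The maps `Φ`, `Φ_Z`, `ψ` -/

/-- The relation `Φ(w W_P) = w' W_Y`, for `w` in the type `C_{n+1}` group and `w'` in the
type `C_n` group (entrywise shift of the first `kk` values). -/
def PhiRel (n kk : ℕ) (w : Equiv.Perm (Fin (2*n+2)))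
    (w' : Equiv.Perm (Fin (2*(n-1)+2))) : Prop :=
  ∀ j, j < kk → ((w' (fn (n-1) j) : ℕ) + 1 = (w (fn n j) : ℕ))

/-- The relation `Φ_Z(w W_P) = w' W_Z` (entrywise shift of the values in positions
`2, …, kk`). -/
def PhiZRel (n kk : ℕ) (w : Equiv.Perm (Fin (2*n+2)))
    (w' : Equiv.Perm (Fin (2*(n-1)+2))) : Prop :=
  ∀ j, j + 1 < kk → ((w' (fn (n-1) j) : ℕ) + 1 = (w (fn n (j+1)) : ℕ))

/-- The word `ψ(s_i)`. -/
def psiWord (kk i : ℕ) : List ℕ :=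
  if i ≤ kk-1 then [i] else if i = kk then [kk, kk+1, kk] else [i+1]

/-- `j ↦ min({2,…,m+1} \ {|w(p)|, …, |w(kk)|})` (1-indexed positions `p ≤ j ≤ kk`). -/
def jmin (m kk p : ℕ) (w : Equiv.Perm (Fin (2*m+2))) : ℕ :=
  sInf {i | 2 ≤ i ∧ i ≤ m+1 ∧ ∀ j, p ≤ j → j ≤ kk → absVal m (w (fn m (j-1))) ≠ i}

/-! ### Partitions -/

/-- `μ ∈ Part(k, N)`, encoded as a function `ℕ → ℤ` supported on `{1, …, k}`. -/
def IsPart (k N : ℕ) (μ : ℕ → ℤ) : Prop :=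
  (∀ j, 1 ≤ j → j < k → μ (j+1) ≤ μ j) ∧ μ 1 ≤ (N:ℤ) - k ∧
  (∀ j, 1 ≤ j → j ≤ k → 0 ≤ μ j) ∧ (∀ j, j = 0 ∨ k < j → μ j = 0)

/-- `D(μ)(i)`: the `i`-th step of the boundary path of the Young diagram of `μ` inside
the `k × (N-k)` rectangle (from northeast to southwest) is vertical. -/
def Dword (k N : ℕ) (μ : ℕ → ℤ) (i : ℕ) : Prop :=
  ∃ j, 1 ≤ j ∧ j ≤ k ∧ (i:ℤ) = (N:ℤ) - k - μ j + j

/-- `μ ∈ BC(k, 2n+2)`. -/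
def IsBCeven (n k : ℕ) (μ : ℕ → ℤ) : Prop :=
  IsPart k (2*n+2) μ ∧
  ∀ i, 1 ≤ i → i ≤ n+1 → ¬(Dword k (2*n+2) μ i ∧ Dword k (2*n+2) μ (2*n+3-i))

/-- `λ + 1^k`. -/
def addOne (k : ℕ) (lam : ℕ → ℤ) (j : ℕ) : ℤ := if 1 ≤ j ∧ j ≤ k then lam j + 1 else 0

/-- `λ ∈ BC(k, 2n+1)`: `λ ∈ Part(k, 2n+1)` and `λ + 1^k ∈ BC(k, 2n+2)`. -/
def IsBCodd (n k : ℕ) (lam : ℕ → ℤ) : Prop :=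
  IsPart k (2*n+1) lam ∧ IsBCeven n k (addOne k lam)

/-- `β ∈ BKT(k, 2n+2)`: `(n+1-k)`-strict partitions. -/
def IsBKTeven (n k : ℕ) (β : ℕ → ℤ) : Prop :=
  IsPart k (2*n+2) β ∧ ∀ j, 1 ≤ j → j < k → ((n:ℤ)+1-k < β j → β (j+1) < β j)

/-- `α ∈ BKT(k, 2n+1)`: `α = β - 1^k` with `β ∈ BKT(k, 2n+2)`. -/
def IsBKTodd (n k : ℕ) (α : ℕ → ℤ) : Prop :=
  IsBKTeven n k (addOne k α) ∧ (∀ j, j = 0 ∨ k < j → α j = 0)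

/-- `ℓ(λ)`: the number of nonzero parts. -/
def numParts (k : ℕ) (lam : ℕ → ℤ) : ℕ :=
  ((Finset.Icc 1 k).filter (fun j => lam j ≠ 0)).card

/-- `ℓ_i^d(λ) = #{j > d : λ_j > i}`. -/
def elld (k : ℕ) (lam : ℕ → ℤ) (i : ℤ) (d : ℕ) : ℕ :=
  ((Finset.Icc 1 k).filter (fun j => d < j ∧ i < lam j)).card

/-- `λ^{O∘(1)} = (λ_2-1, …, λ_{ℓ(λ)}-1, 0, …, 0)`. -/
def Oc1 (k : ℕ) (lam : ℕ → ℤ) (j : ℕ) : ℤ :=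
  if 1 ≤ j ∧ j + 1 ≤ numParts k lam then lam (j+1) - 1 else 0

/-- `λ^{O∘(d)}`. -/
def OcD (k : ℕ) (lam : ℕ → ℤ) : ℕ → ℕ → ℤ
  | 0 => lam
  | d+1 => Oc1 k (OcD k lam d)

/-- `λ^{O_Z(1)} = (λ_1, λ_3-1, …, λ_{ℓ(λ)}-1, 0, …, 0)` for `λ ∈ BC(k, 2n+1)`. -/
def OZ1 (k : ℕ) (lam : ℕ → ℤ) (j : ℕ) : ℤ :=
  if j = 1 then lam 1
  else if 2 ≤ j ∧ j + 1 ≤ numParts k lam then lam (j+1) - 1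
  else 0

/-- `λ^{O_Z(d)}`. -/
def OZd (k : ℕ) (lam : ℕ → ℤ) : ℕ → ℕ → ℤ
  | 0 => lam
  | d+1 => OZ1 k (OZd k lam d)

/-- `Comp_BC(d)`. -/
def CompBC (n k d : ℕ) (lam : ℕ → ℤ) : Prop :=
  IsBCodd n k lam ∧ lam 1 = 2*(n:ℤ)+1-k ∧
  lam (d+1) - (elld k lam ((d:ℤ)-1) (d+1) : ℤ) - d = 2*((n:ℤ)+1-k)

/-- The transposed partition. -/
def transpose (k : ℕ) (μ : ℕ → ℤ) (j : ℕ) : ℤ :=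
  if 1 ≤ j then (((Finset.Icc 1 k).filter (fun i => (j:ℤ) ≤ μ i)).card : ℤ) else 0

/-- `D(μ)(i) = D(μ^t)(i)`. -/
def wingAgree (n k : ℕ) (μ : ℕ → ℤ) (i : ℕ) : Prop :=
  Dword k (2*n+2) μ i ↔ Dword (2*n+2-k) (2*n+2) (transpose k μ) i

/-- `μ ∈ Part(k, 2n+2)` is `m`-wingtip symmetric. -/
def isWingtipEven (n k : ℕ) (μ : ℕ → ℤ) (m : ℕ) : Prop :=
  (∀ i, 1 ≤ i → i ≤ m → wingAgree n k μ i) ∧ (m = 2*n+2 ∨ ¬ wingAgree n k μ (m+1))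

/-- `λ ∈ BC(k, 2n+1)` is `m`-wingtip symmetric. -/
def isWingtip (n k : ℕ) (lam : ℕ → ℤ) (m : ℕ) : Prop :=
  isWingtipEven n k (addOne k lam) m

open scoped Classical in
/-- `λ^{O_Y(1)}` for an `m`-wingtip symmetric `λ ∈ BC(k, 2n+1)` with `λ_1 = 2n+1-k`. -/
def OY1 (n k m : ℕ) (lam : ℕ → ℤ) : ℕ → ℤ :=
  -- the step of `D(λ)` at position `bar m = 2n+3-m`
  let s := 2*n+3-m
  -- the row at (or just above) the step at position `s`
  let i := ((Finset.Icc 1 s).filter (fun t => Dword k (2*n+2) (addOne k lam) t)).card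
  -- the column of the step at position `s` (when horizontal)
  let j := (2*n+2-k) + 1 -
    ((Finset.Icc 1 s).filter (fun t => ¬ Dword k (2*n+2) (addOne k lam) t)).card
  if Dword k (2*n+2) (addOne k lam) s then
    -- `D(λ)(bar m) = 1` is the `i`-th 1: `(λ_2-1, …, λ_{i-1}-1, λ_i, λ_i, λ_{i+1}, …, λ_k)`
    fun p =>
      if 1 ≤ p ∧ p + 2 ≤ i then lam (p+1) - 1
      else if (p = i - 1 ∨ p = i) ∧ 1 ≤ p ∧ p ≤ k then lam i
      else if i + 1 ≤ p ∧ p ≤ k then lam p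
      else 0
  else
    -- horizontal step at the bottom of row `i`, column `j`:
    -- `(λ_2-1, …, λ_i-1, j, λ_{i+1}, …, λ_k)`
    fun p =>
      if 1 ≤ p ∧ p + 1 ≤ i then lam (p+1) - 1
      else if p = i ∧ 1 ≤ p ∧ p ≤ k then (j:ℤ)
      else if i + 1 ≤ p ∧ p ≤ k then lam p
      else 0

/-- `λ^{O_Y(d)} = (λ^{O_Y(1)})^{O∘(d-1)}`. -/
def OYd (n k m : ℕ) (lam : ℕ → ℤ) (d : ℕ) : ℕ → ℤ := OcD k (OY1 n k m lam) (d-1)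

open scoped Classical in
/-- `α^{O_Z(1)}` for `α ∈ BKT(k, 2n+1)` with `α_1 = 2n+1-k`. -/
def OZ1bkt (n k : ℕ) (α : ℕ → ℤ) : ℕ → ℤ :=
  if ∃ j, 3 ≤ j ∧ j ≤ k ∧ α 2 + α j ≤ 2*((n:ℤ)-k)+j-2 then
    -- `j0` minimal such that `α_2 + α_{j0} ≤ 2(n-k)+j0-2`
    let j0 := sInf {j | 3 ≤ j ∧ j ≤ k ∧ α 2 + α j ≤ 2*((n:ℤ)-k)+j-2}
    fun p =>
      if p = 1 then α 1
      else if 2 ≤ p ∧ p + 2 ≤ j0 then α (p+1)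
      else if j0 ≤ p + 1 ∧ p + 1 ≤ k then max (α (p+1) - 1) (-1)
      else if p = k then -1 else 0
  else
    fun p =>
      if p = 1 then α 1
      else if 2 ≤ p ∧ p + 1 ≤ k then α (p+1)
      else if p = k then -1 else 0

/-- `α^{O_Z(d)}`. -/
def OZdbkt (n k : ℕ) (α : ℕ → ℤ) : ℕ → ℕ → ℤ
  | 0 => α
  | d+1 => OZ1bkt n k (OZdbkt n k α d)

/-- `Comp_BKT(d)`. -/
def CompBKT (n k d : ℕ) (α : ℕ → ℤ) : Prop :=
  IsBKTodd n k α ∧ α 1 = 2*(n:ℤ)+1-k ∧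
  (OZdbkt n k α (d-1)) 2 - (elld k (OZdbkt n k α (d-1)) (-1) 2 : ℤ) = 2*((n:ℤ)+1-k)

/-- `ℓ_{-1}(α) = max {j : α_j > -1}`. -/
def ellNeg (k : ℕ) (α : ℕ → ℤ) : ℕ :=
  ((Finset.Icc 1 k).filter (fun j => (-1:ℤ) < α j)).sup id

/-- `α^{O_Y(1)} = (α_2, …, α_{ℓ_{-1}(α)}, 0, …, 0)` for `α ∈ BKT(k, 2n+1)` with
`α_1 = 2n+1-k`. -/
def OY1bkt (k : ℕ) (α : ℕ → ℤ) (j : ℕ) : ℤ :=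
  if 1 ≤ j ∧ j + 1 ≤ ellNeg k α then α (j+1) else 0

/-! ### Correspondences between partitions and Weyl group elements -/

/-- The 01-word correspondence between `μ ∈ BC(k, 2n+2)` and `w ∈ W^P`: for a 1-indexed
value `a ∈ {1, …, n+1}`, `a` occurs among the first `k` values of `w` iff `D(μ)(a) = 1`,
and `bar a` occurs iff `D(μ)(2n+3-a) = 1`. -/
def BCrel (n k : ℕ) (μ : ℕ → ℤ) (w : Equiv.Perm (Fin (2*n+2))) : Prop :=
  ∀ i, 1 ≤ i → i ≤ n+1 →
    ((fn n (i-1) ∈ valSet n k w) ↔ Dword k (2*n+2) μ i) ∧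
    ((fn n (2*n+2-i) ∈ valSet n k w) ↔ Dword k (2*n+2) μ (2*n+3-i))

/-- The BKT correspondence between `β ∈ BKT(k, 2n+2)` and `w ∈ W^P`:
`β_j = 2n+3-k-w(j) + #{i < j : w(i)+w(j) > 2n+3}` (1-indexed values). -/
def BKTrel (n k : ℕ) (β : ℕ → ℤ) (w : Equiv.Perm (Fin (2*n+2))) : Prop :=
  ∀ j, 1 ≤ j → j ≤ k →
    β j = 2*(n:ℤ)+3-k - ((w (fn n (j-1)) : ℕ) + 1) +
      (((Finset.Icc 1 (j-1)).filter
        (fun i => 2*n+1 < (w (fn n (i-1)) : ℕ) + (w (fn n (j-1)) : ℕ))).card : ℤ)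


/-! ### Signed permutations and simple reflections -/

theorem fn_val {m i : ℕ} (h : i < 2*m+2) : (fn m i : ℕ) = i := Nat.mod_eq_of_lt h

theorem fn_self {m : ℕ} (x : Fin (2*m+2)) : fn m x = x := Fin.ext (fn_val x.isLt)

theorem bar_val (m : ℕ) (x : Fin (2*m+2)) : (bar m x : ℕ) = 2*m+1 - x := rfl

theorem mem_Weyl_iff {m : ℕ} {w : Equiv.Perm (Fin (2*m+2))} :
    w ∈ Weyl m ↔ ∀ x, w (bar m x) = bar m (w x) := by
  constructor
  · intro h x
    exact (Equiv.congr_fun (Subgroup.mem_centralizer_iff.1 h (barPerm m) rfl) x).symm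
  · intro h
    refine Subgroup.mem_centralizer_iff.2 fun b hb => ?_
    rw [Set.mem_singleton_iff.1 hb]
    exact Equiv.ext fun x => (h x).symm

theorem sRefl_val {m i : ℕ} (h1 : 1 ≤ i) (h2 : i ≤ m+1) (x : Fin (2*m+2)) :
    (sRefl m i x : ℕ) = if (x : ℕ) = i-1 then i else if (x : ℕ) = i then i-1 else
      if (x : ℕ) = 2*m+1-i then 2*m+2-i else if (x : ℕ) = 2*m+2-i then 2*m+1-i else x := by
  have hx := x.isLt
  have e1 : (fn m (i-1) : ℕ) = i-1 := fn_val (by omega)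
  have e2 : (fn m i : ℕ) = i := fn_val (by omega)
  have e3 : (fn m (2*m+2-i) : ℕ) = 2*m+2-i := fn_val (by omega)
  have e4 : (fn m (2*m+1-i) : ℕ) = 2*m+1-i := fn_val (by omega)
  have e5 : (fn m m : ℕ) = m := fn_val (by omega)
  have e6 : (fn m (m+1) : ℕ) = m+1 := fn_val (by omega)
  unfold sRefl
  split_ifs <;> simp only [Equiv.Perm.mul_apply, Equiv.swap_apply_def, Fin.ext_iff] <;>
    split_ifs <;> omega

theorem sRefl_cases {m i : ℕ} (h1 : 1 ≤ i) (h2 : i ≤ m+1) (x : Fin (2*m+2)) :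
    ((x : ℕ) = i-1 ∧ (sRefl m i x : ℕ) = i) ∨ ((x : ℕ) = i ∧ (sRefl m i x : ℕ) = i-1) ∨
    ((x : ℕ) = 2*m+1-i ∧ (sRefl m i x : ℕ) = 2*m+2-i) ∨
    ((x : ℕ) = 2*m+2-i ∧ (sRefl m i x : ℕ) = 2*m+1-i) ∨
    ((x : ℕ) ≠ i-1 ∧ (x : ℕ) ≠ i ∧ (x : ℕ) ≠ 2*m+1-i ∧ (x : ℕ) ≠ 2*m+2-i ∧
      (sRefl m i x : ℕ) = x) := by
  rw [sRefl_val h1 h2]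
  split_ifs <;> omega

/-- A simple reflection preserves the order of every pair of positions except the two
mirror-image adjacent pairs it exchanges. -/
theorem sRefl_lt_iff {m i : ℕ} (h1 : 1 ≤ i) (h2 : i ≤ m+1) (x y : Fin (2*m+2))
    (hxy : ¬ ((x : ℕ) = i-1 ∧ (y : ℕ) = i)) (hyx : ¬ ((x : ℕ) = i ∧ (y : ℕ) = i-1))
    (hxy' : ¬ ((x : ℕ) = 2*m+1-i ∧ (y : ℕ) = 2*m+2-i))
    (hyx' : ¬ ((x : ℕ) = 2*m+2-i ∧ (y : ℕ) = 2*m+1-i)) :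
    (sRefl m i x : ℕ) < sRefl m i y ↔ (x : ℕ) < y := by
  have hx := sRefl_cases h1 h2 x
  have hy := sRefl_cases h1 h2 y
  omega

theorem sRefl_mul_self {m i : ℕ} (h1 : 1 ≤ i) (h2 : i ≤ m+1) : sRefl m i * sRefl m i = 1 := by
  ext x
  have hx := x.isLt
  simp only [Equiv.Perm.mul_apply, sRefl_val h1 h2, Equiv.Perm.one_apply]
  split_ifs <;> omega

theorem sRefl_sRefl {m i : ℕ} (h1 : 1 ≤ i) (h2 : i ≤ m+1) (x : Fin (2*m+2)) :
    sRefl m i (sRefl m i x) = x := by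
  rw [← Equiv.Perm.mul_apply, sRefl_mul_self h1 h2, Equiv.Perm.one_apply]

theorem apply_sRefl_pred {m i : ℕ} (h1 : 1 ≤ i) (h2 : i ≤ m+1) :
    sRefl m i (fn m (i-1)) = fn m i := by
  apply Fin.ext
  rw [sRefl_val h1 h2, fn_val (by omega), fn_val (by omega), if_pos rfl]

theorem apply_sRefl_self {m i : ℕ} (h1 : 1 ≤ i) (h2 : i ≤ m+1) :
    sRefl m i (fn m i) = fn m (i-1) := by
  rw [← apply_sRefl_pred h1 h2, sRefl_sRefl h1 h2]

theorem mul_sRefl_cancel {m i : ℕ} (h1 : 1 ≤ i) (h2 : i ≤ m+1) (w : Equiv.Perm (Fin (2*m+2))) :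
    w * sRefl m i * sRefl m i = w := by
  rw [mul_assoc, sRefl_mul_self h1 h2, mul_one]

theorem sRefl_mem_Weyl {m i : ℕ} (h1 : 1 ≤ i) (h2 : i ≤ m+1) : sRefl m i ∈ Weyl m := by
  rw [mem_Weyl_iff]
  intro x
  have hx := x.isLt
  have a := sRefl_cases h1 h2 x
  have b := sRefl_cases h1 h2 (bar m x)
  apply Fin.ext
  rw [bar_val] at b ⊢
  omega

theorem Weyl_val {m : ℕ} {w : Equiv.Perm (Fin (2*m+2))} (hw : w ∈ Weyl m) (x : Fin (2*m+2)) :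
    (w (bar m x) : ℕ) = 2*m+1 - w x := by
  rw [mem_Weyl_iff.1 hw, bar_val]

theorem Weyl_val_of_add {m : ℕ} {w : Equiv.Perm (Fin (2*m+2))} (hw : w ∈ Weyl m)
    {x y : Fin (2*m+2)} (h : (x : ℕ) + y = 2*m+1) : (w x : ℕ) + w y = 2*m+1 := by
  have : y = bar m x := by apply Fin.ext; rw [bar_val]; omega
  have hx := (w x).isLt
  rw [this, Weyl_val hw]
  omega

/-! ### Coxeter length -/

/-- Twice the number of positive roots made negative by `w`. -/
def invTwice (m : ℕ) (w : Equiv.Perm (Fin (2*m+2))) : ℕ :=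
  ∑ x : Fin (2*m+2) × Fin (2*m+2),
    if x.1 < x.2 ∧ w x.2 < w x.1 then (if (x.1 : ℕ) + x.2 = 2*m+1 then 2 else 1) else 0

theorem invTwice_mul_sRefl {m i : ℕ} (h1 : 1 ≤ i) (h2 : i ≤ m+1)
    {w : Equiv.Perm (Fin (2*m+2))} (hw : w ∈ Weyl m) (h : w (fn m (i-1)) < w (fn m i)) :
    invTwice m (w * sRefl m i) = invTwice m w + 2 := by
  have e1 : (fn m (i-1) : ℕ) = i-1 := fn_val (by omega)
  have e2 : (fn m i : ℕ) = i := fn_val (by omega)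
  have e3 : (fn m (2*m+2-i) : ℕ) = 2*m+2-i := fn_val (by omega)
  have e4 : (fn m (2*m+1-i) : ℕ) = 2*m+1-i := fn_val (by omega)
  have a1 := Weyl_val_of_add hw (x := fn m (i-1)) (y := fn m (2*m+2-i)) (by omega)
  have a2 := Weyl_val_of_add hw (x := fn m i) (y := fn m (2*m+1-i)) (by omega)
  set D : Finset (Fin (2*m+2) × Fin (2*m+2)) :=
    {(fn m i, fn m (i-1)), (fn m (2*m+2-i), fn m (2*m+1-i))} with hD
  have key : invTwice m (w * sRefl m i) = invTwice m w +
      ∑ x ∈ D, (if (x.1 : ℕ) + x.2 = 2*m+1 then 2 else 1) := by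
    unfold invTwice
    rw [← Equiv.sum_comp ((sRefl m i).prodCongr (sRefl m i)), ← Finset.sum_filter_add_sum_filter_not
      Finset.univ (· ∈ D), ← Finset.sum_filter_add_sum_filter_not Finset.univ (· ∈ D) (fun x => ite
        (x.1 < x.2 ∧ w x.2 < w x.1) _ _)]
    have hmem : ∀ x : Fin (2*m+2) × Fin (2*m+2), x ∈ D ↔
        ((x.1 : ℕ) = i ∧ (x.2 : ℕ) = i-1) ∨ ((x.1 : ℕ) = 2*m+2-i ∧ (x.2 : ℕ) = 2*m+1-i) := by
      intro x
      simp only [hD, Finset.mem_insert, Finset.mem_singleton, Prod.ext_iff, Fin.ext_iff,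
        e1, e2, e3, e4]
    have z : ∑ x with x ∈ D, (if x.1 < x.2 ∧ w x.2 < w x.1 then
        (if (x.1 : ℕ) + x.2 = 2*m+1 then 2 else 1) else 0) = 0 := by
      refine Finset.sum_eq_zero fun x hx => if_neg ?_
      simp only [Finset.mem_filter, Finset.mem_univ, true_and, hmem, Fin.lt_def] at hx ⊢
      omega
    rw [z, zero_add, add_comm, Finset.filter_mem_eq_inter, Finset.univ_inter]
    have hsum : ∀ x y : Fin (2*m+2), (sRefl m i x : ℕ) + sRefl m i y = 2*m+1 ↔
        (x : ℕ) + y = 2*m+1 := by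
      intro x y
      have hx := sRefl_cases h1 h2 x
      have hy := sRefl_cases h1 h2 y
      omega
    congr 1
    · refine Finset.sum_congr rfl fun x hx => ?_
      obtain ⟨x, y⟩ := x
      simp only [Finset.mem_filter, Finset.mem_univ, true_and, hmem] at hx
      simp only [Equiv.prodCongr_apply, Prod.map_apply, Equiv.Perm.mul_apply, sRefl_sRefl h1 h2,
        Fin.lt_def, hsum]
      by_cases c1 : (x : ℕ) = i-1 ∧ (y : ℕ) = i
      · obtain rfl : x = fn m (i-1) := Fin.ext (by omega)
        obtain rfl : y = fn m i := Fin.ext (by omega)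
        rw [Fin.lt_def] at h
        rw [apply_sRefl_pred h1 h2, apply_sRefl_self h1 h2, if_neg (by omega), if_neg (by omega)]
      by_cases c2 : (x : ℕ) = 2*m+1-i ∧ (y : ℕ) = 2*m+2-i
      · obtain rfl : x = fn m (2*m+1-i) := Fin.ext (by omega)
        obtain rfl : y = fn m (2*m+2-i) := Fin.ext (by omega)
        rw [Fin.lt_def] at h
        rw [if_neg, if_neg (by omega)]
        omega
      simp only [sRefl_lt_iff h1 h2 x y c1 (by omega) c2 (by omega)]
    · refine Finset.sum_congr rfl fun x hx => ?_
      obtain ⟨x, y⟩ := x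
      rw [hmem] at hx
      dsimp only at hx
      simp only [Equiv.prodCongr_apply, Prod.map_apply, Equiv.Perm.mul_apply, sRefl_sRefl h1 h2,
        hsum]
      refine if_pos ?_
      rw [Fin.lt_def] at h
      rw [Fin.lt_def, Fin.lt_def]
      have hx' := sRefl_cases h1 h2 x
      have hy' := sRefl_cases h1 h2 y
      rcases hx with hx | hx
      · obtain rfl : x = fn m i := Fin.ext (by omega)
        obtain rfl : y = fn m (i-1) := Fin.ext (by omega)
        omega
      · obtain rfl : x = fn m (2*m+2-i) := Fin.ext (by omega)
        obtain rfl : y = fn m (2*m+1-i) := Fin.ext (by omega)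
        omega
  rw [key]
  congr 1
  by_cases hi : i = m+1
  · have : D = {(fn m i, fn m (i-1))} := by
      rw [hD, show 2*m+2-i = i by omega, show 2*m+1-i = i-1 by omega, Finset.pair_eq_singleton]
    rw [this, Finset.sum_singleton, if_pos (by simp only [e1, e2]; omega)]
  · rw [hD, Finset.sum_pair (by simp only [ne_eq, Prod.ext_iff, Fin.ext_iff]; omega),
      if_neg (by simp only [e1, e2]; omega), if_neg (by simp only [e3, e4]; omega)]

theorem fn_pred_ne {m i : ℕ} (h1 : 1 ≤ i) (h2 : i ≤ m+1) : fn m (i-1) ≠ fn m i := by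
  rw [ne_eq, Fin.ext_iff, fn_val (by omega), fn_val (by omega)]
  omega

theorem invTwice_mul_sRefl_of_descent {m i : ℕ} (h1 : 1 ≤ i) (h2 : i ≤ m+1)
    {w : Equiv.Perm (Fin (2*m+2))} (hw : w ∈ Weyl m) (h : w (fn m i) < w (fn m (i-1))) :
    invTwice m w = invTwice m (w * sRefl m i) + 2 := by
  have := invTwice_mul_sRefl h1 h2 (mul_mem hw (sRefl_mem_Weyl h1 h2))
    (by simpa only [Equiv.Perm.mul_apply, apply_sRefl_pred h1 h2, apply_sRefl_self h1 h2] using h)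
  rwa [mul_sRefl_cancel h1 h2] at this

theorem ascent_or_descent {m i : ℕ} (h1 : 1 ≤ i) (h2 : i ≤ m+1) (w : Equiv.Perm (Fin (2*m+2))) :
    w (fn m (i-1)) < w (fn m i) ∨ w (fn m i) < w (fn m (i-1)) :=
  lt_or_gt_of_ne (w.injective.ne (fn_pred_ne h1 h2))

theorem eq_one_of_ascents {m : ℕ} {w : Equiv.Perm (Fin (2*m+2))} (hw : w ∈ Weyl m)
    (h : ∀ i, 1 ≤ i → i ≤ m+1 → w (fn m (i-1)) < w (fn m i)) : w = 1 := by
  have hmono : StrictMono w := by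
    refine Fin.strictMono_iff_lt_succ.2 fun x => ?_
    have hx := x.isLt
    by_cases hm : (x : ℕ) ≤ m
    · have := h (x+1) (by omega) (by omega)
      have e1 : fn m (x+1-1) = x.castSucc := Fin.ext (by rw [fn_val (by omega)]; simp)
      have e2 : fn m (x+1) = x.succ := Fin.ext (by rw [fn_val (by omega)]; simp)
      rwa [e1, e2] at this
    · have := h (2*m+1-x) (by omega) (by omega)
      have a1 := Weyl_val_of_add hw (x := x.castSucc) (y := fn m (2*m+1-x))
        (by rw [fn_val (by omega), Fin.val_castSucc]; omega)
      have a2 := Weyl_val_of_add hw (x := x.succ) (y := fn m (2*m+1-x-1))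
        (by rw [fn_val (by omega), Fin.val_succ]; omega)
      rw [Fin.lt_def] at this ⊢
      omega
  have := Subsingleton.elim (hmono.orderIsoOfSurjective w w.surjective) (OrderIso.refl _)
  exact Equiv.ext fun x => DFunLike.congr_fun this x

theorem exists_descent {m : ℕ} {w : Equiv.Perm (Fin (2*m+2))} (hw : w ∈ Weyl m) (h : w ≠ 1) :
    ∃ i, 1 ≤ i ∧ i ≤ m+1 ∧ w (fn m i) < w (fn m (i-1)) := by
  by_contra! hc
  exact h (eq_one_of_ascents hw fun i h1 h2 =>
    (hc i h1 h2).lt_of_ne (w.injective.ne (fn_pred_ne h1 h2)))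

theorem prod_sRefl_mem {m : ℕ} {l : List ℕ} (hl : ∀ i ∈ l, 1 ≤ i ∧ i ≤ m+1) :
    (l.map (sRefl m)).prod ∈ Weyl m := by
  refine Subgroup.list_prod_mem _ fun x hx => ?_
  obtain ⟨i, hi, rfl⟩ := List.mem_map.1 hx
  exact sRefl_mem_Weyl (hl i hi).1 (hl i hi).2

theorem invTwice_prod_le {m : ℕ} (l : List ℕ) (hl : ∀ i ∈ l, 1 ≤ i ∧ i ≤ m+1) :
    invTwice m (l.map (sRefl m)).prod ≤ 2 * l.length := by
  induction l using List.reverseRecOn with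
  | nil =>
    simp only [invTwice, List.map_nil, List.prod_nil, Equiv.Perm.one_apply, List.length_nil]
    refine (Finset.sum_eq_zero fun x _ => if_neg ?_).le
    exact fun h => lt_asymm h.1 h.2
  | append_singleton l i ih =>
    have hl' : ∀ j ∈ l, 1 ≤ j ∧ j ≤ m+1 := fun j hj => hl j (by simp [hj])
    obtain ⟨h1, h2⟩ := hl i (by simp)
    have := ih hl'
    simp only [List.map_append, List.map_cons, List.map_nil, List.prod_append, List.prod_cons,
      List.prod_nil, mul_one, List.length_append, List.length_cons, List.length_nil]
    rcases ascent_or_descent h1 h2 (l.map (sRefl m)).prod with h | h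
    · have := invTwice_mul_sRefl h1 h2 (prod_sRefl_mem hl') h
      omega
    · have := invTwice_mul_sRefl_of_descent h1 h2 (prod_sRefl_mem hl') h
      omega

theorem exists_word {m : ℕ} (N : ℕ) {w : Equiv.Perm (Fin (2*m+2))} (hw : w ∈ Weyl m)
    (hN : invTwice m w ≤ N) : ∃ l : List ℕ, (∀ i ∈ l, 1 ≤ i ∧ i ≤ m+1) ∧
      (l.map (sRefl m)).prod = w ∧ 2 * l.length ≤ invTwice m w := by
  induction N using Nat.strong_induction_on generalizing w with
  | _ N ih =>
    by_cases h1w : w = 1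
    · exact ⟨[], by simp, by simp [h1w], by simp⟩
    · obtain ⟨i, h1, h2, h⟩ := exists_descent hw h1w
      have e := invTwice_mul_sRefl_of_descent h1 h2 hw h
      obtain ⟨l, hl, hp, hlen⟩ := ih (N-2) (by omega) (mul_mem hw (sRefl_mem_Weyl h1 h2))
        (by omega)
      refine ⟨l ++ [i], ?_, ?_, ?_⟩
      · intro j hj
        rcases List.mem_append.1 hj with hj | hj
        · exact hl j hj
        · rw [List.mem_singleton.1 hj]; exact ⟨h1, h2⟩
      · simp [hp, mul_sRefl_cancel h1 h2]
      · simp only [List.length_append, List.length_cons, List.length_nil]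
        omega

theorem two_mul_len {m : ℕ} {w : Equiv.Perm (Fin (2*m+2))} (hw : w ∈ Weyl m) :
    2 * len m w = invTwice m w := by
  obtain ⟨l, hl, hp, hlen⟩ := exists_word _ hw le_rfl
  have hle : len m w ≤ l.length := Nat.sInf_le ⟨l, rfl, hl, hp⟩
  obtain ⟨l', h', hl', hp'⟩ := Nat.sInf_mem (s := {r | ∃ l : List ℕ, l.length = r ∧
    (∀ i ∈ l, 1 ≤ i ∧ i ≤ m+1) ∧ (l.map (sRefl m)).prod = w}) ⟨_, l, rfl, hl, hp⟩
  have := invTwice_prod_le l' hl'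
  rw [hp', h'] at this
  change invTwice m w ≤ 2 * len m w at this
  omega

theorem len_mul_sRefl {m i : ℕ} (h1 : 1 ≤ i) (h2 : i ≤ m+1)
    {w : Equiv.Perm (Fin (2*m+2))} (hw : w ∈ Weyl m) (h : w (fn m (i-1)) < w (fn m i)) :
    len m (w * sRefl m i) = len m w + 1 := by
  have a := two_mul_len hw
  have b := two_mul_len (mul_mem hw (sRefl_mem_Weyl h1 h2))
  have c := invTwice_mul_sRefl h1 h2 hw h
  omega

theorem len_mul_sRefl_of_descent {m i : ℕ} (h1 : 1 ≤ i) (h2 : i ≤ m+1)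
    {w : Equiv.Perm (Fin (2*m+2))} (hw : w ∈ Weyl m) (h : w (fn m i) < w (fn m (i-1))) :
    len m w = len m (w * sRefl m i) + 1 := by
  have a := two_mul_len hw
  have b := two_mul_len (mul_mem hw (sRefl_mem_Weyl h1 h2))
  have c := invTwice_mul_sRefl_of_descent h1 h2 hw h
  omega

/-! ### Reflections and the Bruhat order -/

/-- The reflection exchanging the positions `p` and `q`, together with their mirror images. -/
def pairRefl (m : ℕ) (p q : Fin (2*m+2)) : Equiv.Perm (Fin (2*m+2)) :=
  if q = bar m p then Equiv.swap p q else Equiv.swap p q * Equiv.swap (bar m p) (bar m q)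

theorem swap_cases {N : ℕ} (a b x : Fin N) :
    ((x : ℕ) = a ∧ (Equiv.swap a b x : ℕ) = b) ∨ ((x : ℕ) = b ∧ (Equiv.swap a b x : ℕ) = a) ∨
    ((x : ℕ) ≠ a ∧ (x : ℕ) ≠ b ∧ (Equiv.swap a b x : ℕ) = x) := by
  simp only [Equiv.swap_apply_def, Fin.ext_iff]
  split_ifs <;> omega

theorem pairRefl_cases {m : ℕ} (p q x : Fin (2*m+2)) :
    ((x : ℕ) = p ∧ (pairRefl m p q x : ℕ) = q) ∨ ((x : ℕ) = q ∧ (pairRefl m p q x : ℕ) = p) ∨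
    ((x : ℕ) + p = 2*m+1 ∧ (pairRefl m p q x : ℕ) + q = 2*m+1) ∨
    ((x : ℕ) + q = 2*m+1 ∧ (pairRefl m p q x : ℕ) + p = 2*m+1) ∨
    ((x : ℕ) ≠ p ∧ (x : ℕ) ≠ q ∧ (x : ℕ) + p ≠ 2*m+1 ∧ (x : ℕ) + q ≠ 2*m+1 ∧
      (pairRefl m p q x : ℕ) = x) := by
  have hp := p.isLt
  have hq := q.isLt
  have hx := x.isLt
  unfold pairRefl
  split_ifs with h
  · rw [Fin.ext_iff, bar_val] at h
    simp only [Equiv.swap_apply_def, Fin.ext_iff]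
    split_ifs <;> omega
  · rw [Fin.ext_iff, bar_val] at h
    rw [Equiv.Perm.mul_apply]
    have a1 := swap_cases (bar m p) (bar m q) x
    have a2 := swap_cases p q (Equiv.swap (bar m p) (bar m q) x)
    rw [bar_val, bar_val] at a1
    rcases a1 with a1 | a1 | a1
    · have : (Equiv.swap p q (Equiv.swap (bar m p) (bar m q) x) : ℕ) = 2*m+1-q := by omega
      exact Or.inr (Or.inr (Or.inl (by omega)))
    · have : (Equiv.swap p q (Equiv.swap (bar m p) (bar m q) x) : ℕ) = 2*m+1-p := by omega
      exact Or.inr (Or.inr (Or.inr (Or.inl (by omega))))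
    · rw [a1.2.2] at a2
      rcases a2 with a2 | a2 | a2
      · exact Or.inl a2
      · exact Or.inr (Or.inl a2)
      · exact Or.inr (Or.inr (Or.inr (Or.inr ⟨a2.1, a2.2.1, by omega, by omega, a2.2.2⟩)))

theorem mul_pairRefl {m : ℕ} {g : Equiv.Perm (Fin (2*m+2))} (hg : g ∈ Weyl m)
    (p q : Fin (2*m+2)) : g * pairRefl m p q = pairRefl m (g p) (g q) * g := by
  have h : q = bar m p ↔ g q = bar m (g p) := by
    rw [← mem_Weyl_iff.1 hg, g.injective.eq_iff]
  unfold pairRefl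
  by_cases hq : q = bar m p
  · rw [if_pos hq, if_pos (h.1 hq), Equiv.mul_swap_eq_swap_mul]
  · rw [if_neg hq, if_neg (fun e => hq (h.2 e)), ← mul_assoc,
      Equiv.mul_swap_eq_swap_mul g p q, mul_assoc, Equiv.mul_swap_eq_swap_mul g, mem_Weyl_iff.1 hg,
      mem_Weyl_iff.1 hg, mul_assoc]

theorem pairRefl_mem_Weyl {m : ℕ} (p q : Fin (2*m+2)) : pairRefl m p q ∈ Weyl m := by
  rw [mem_Weyl_iff]
  intro x
  have a := pairRefl_cases p q x
  have b := pairRefl_cases p q (bar m x)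
  have hx := x.isLt
  have hp := p.isLt
  have hq := q.isLt
  apply Fin.ext
  rw [bar_val] at b ⊢
  omega

theorem pairRefl_left {m : ℕ} (p q : Fin (2*m+2)) : pairRefl m p q p = q := by
  have a := pairRefl_cases p q p
  apply Fin.ext
  omega

theorem pairRefl_right {m : ℕ} (p q : Fin (2*m+2)) : pairRefl m p q q = p := by
  have a := pairRefl_cases p q q
  apply Fin.ext
  omega

theorem pairRefl_eq_sRefl {m i : ℕ} (h1 : 1 ≤ i) (h2 : i ≤ m+1) {p q : Fin (2*m+2)}
    (h : ((p : ℕ) = i-1 ∧ (q : ℕ) = i) ∨ ((p : ℕ) = 2*m+1-i ∧ (q : ℕ) = 2*m+2-i)) :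
    pairRefl m p q = sRefl m i := by
  ext x
  have a := pairRefl_cases p q x
  have b := sRefl_cases h1 h2 x
  omega

/-- `b` is obtained from `a` by exchanging two entries that are in increasing order. -/
def BruhatEdge (m : ℕ) (a b : Equiv.Perm (Fin (2*m+2))) : Prop :=
  ∃ p q, p < q ∧ a p < a q ∧ b = a * pairRefl m p q

theorem BruhatEdge.mul_sRefl {m i : ℕ} (h1 : 1 ≤ i) (h2 : i ≤ m+1)
    {a b : Equiv.Perm (Fin (2*m+2))} (h : BruhatEdge m a b) :
    b = a * sRefl m i ∨ BruhatEdge m (a * sRefl m i) (b * sRefl m i) := by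
  obtain ⟨p, q, hpq, hapq, rfl⟩ := h
  by_cases hs : sRefl m i p < sRefl m i q
  · refine Or.inr ⟨_, _, hs, ?_, ?_⟩
    · simpa only [Equiv.Perm.mul_apply, sRefl_sRefl h1 h2] using hapq
    · rw [mul_assoc, mul_assoc, mul_pairRefl (sRefl_mem_Weyl h1 h2), sRefl_sRefl h1 h2,
        sRefl_sRefl h1 h2]
  · left
    rw [pairRefl_eq_sRefl h1 h2]
    have hp := p.isLt
    have hq := q.isLt
    rw [Fin.lt_def] at hs hpq
    by_contra hc
    have := sRefl_lt_iff h1 h2 p q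
    omega

theorem BruhatEdge.mem_Weyl {m : ℕ} {a b : Equiv.Perm (Fin (2*m+2))} (h : BruhatEdge m a b)
    (ha : a ∈ Weyl m) : b ∈ Weyl m := by
  obtain ⟨p, q, -, -, rfl⟩ := h
  exact mul_mem ha (pairRefl_mem_Weyl _ _)

theorem sRefl_mem_reflections {m i : ℕ} (h1 : 1 ≤ i) (h2 : i ≤ m+1) : sRefl m i ∈ reflections m :=
  ⟨1, one_mem _, i, h1, h2, by simp⟩

theorem sRefl_conj_mem_reflections {m i : ℕ} (h1 : 1 ≤ i) (h2 : i ≤ m+1)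
    {t : Equiv.Perm (Fin (2*m+2))} (ht : t ∈ reflections m) :
    sRefl m i * t * sRefl m i ∈ reflections m := by
  obtain ⟨u, hu, j, hj1, hj2, rfl⟩ := ht
  refine ⟨sRefl m i * u, mul_mem (sRefl_mem_Weyl h1 h2) hu, j, hj1, hj2, ?_⟩
  rw [mul_inv_rev, inv_eq_of_mul_eq_one_left (sRefl_mul_self h1 h2)]
  simp only [mul_assoc]

theorem BruhatEdge.exists_reflection {m : ℕ} {a b : Equiv.Perm (Fin (2*m+2))} (ha : a ∈ Weyl m)
    (h : BruhatEdge m a b) : ∃ t ∈ reflections m, b = a * t ∧ len m a < len m b := by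
  induction hN : len m b using Nat.strong_induction_on generalizing a b with
  | _ N ih =>
    have hb : b ∈ Weyl m := h.mem_Weyl ha
    have hb1 : b ≠ 1 := by
      obtain ⟨p, q, hpq, hapq, hb⟩ := h
      have e1 : b p = a q := by rw [hb, Equiv.Perm.mul_apply, pairRefl_left _ _]
      have e2 : b q = a p := by rw [hb, Equiv.Perm.mul_apply, pairRefl_right _ _]
      rintro rfl
      rw [← e1, ← e2] at hapq
      exact lt_asymm hpq hapq
    obtain ⟨i, h1, h2, hd⟩ := exists_descent hb hb1
    have hlen := len_mul_sRefl_of_descent h1 h2 hb hd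
    rcases h.mul_sRefl h1 h2 with rfl | h'
    · rw [mul_sRefl_cancel h1 h2] at hlen
      exact ⟨_, sRefl_mem_reflections h1 h2, rfl, by omega⟩
    · have has := mul_mem ha (sRefl_mem_Weyl h1 h2)
      obtain ⟨t, ht, e, hlt⟩ := ih _ (by omega) has h' rfl
      refine ⟨_, sRefl_conj_mem_reflections h1 h2 ht, ?_, ?_⟩
      · rw [← mul_assoc, ← mul_assoc, ← e, mul_sRefl_cancel h1 h2]
      · rcases ascent_or_descent h1 h2 a with ha' | ha'
        · have := len_mul_sRefl h1 h2 ha ha'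
          omega
        · have := len_mul_sRefl_of_descent h1 h2 ha ha'
          omega

theorem bruhatLE_of_edges {m : ℕ} {a b : Equiv.Perm (Fin (2*m+2))} (ha : a ∈ Weyl m)
    (h : Relation.ReflTransGen (BruhatEdge m) a b) : bruhatLE m a b := by
  induction h using Relation.ReflTransGen.head_induction_on with
  | refl => exact Relation.ReflTransGen.refl
  | head hab _ ih => exact (ih (hab.mem_Weyl ha)).head (hab.exists_reflection ha)

theorem edges_mul_sRefl {m i : ℕ} (h1 : 1 ≤ i) (h2 : i ≤ m+1) {a b : Equiv.Perm (Fin (2*m+2))}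
    (h : Relation.ReflTransGen (BruhatEdge m) a b) :
    Relation.ReflTransGen (BruhatEdge m) a (b * sRefl m i) ∨
      Relation.ReflTransGen (BruhatEdge m) (a * sRefl m i) (b * sRefl m i) := by
  induction h using Relation.ReflTransGen.head_induction_on with
  | refl => exact Or.inr Relation.ReflTransGen.refl
  | head hac _ ih =>
    rcases hac.mul_sRefl h1 h2 with rfl | h'
    · rw [mul_sRefl_cancel h1 h2] at ih
      exact ih.symm
    · rcases ih with ih | ih
      · exact Or.inl (ih.head hac)
      · exact Or.inr (ih.head h')

/-! ### The parabolic subgroup and minimal representatives -/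

theorem sRefl_mem_WP {m k i : ℕ} (h1 : 1 ≤ i) (h2 : i ≤ m+1) (hik : i ≠ k) : sRefl m i ∈ WP m k :=
  Subgroup.subset_closure ⟨i, h1, h2, hik, rfl⟩

theorem WP_le_Weyl (m k : ℕ) : WP m k ≤ Weyl m := by
  refine (Subgroup.closure_le _).2 ?_
  rintro _ ⟨i, h1, h2, -, rfl⟩
  exact sRefl_mem_Weyl h1 h2

theorem WP_apply_lt_iff {m k : ℕ} (hk : k ≤ m) {g : Equiv.Perm (Fin (2*m+2))} (hg : g ∈ WP m k)
    (x : Fin (2*m+2)) : (g x : ℕ) < k ↔ (x : ℕ) < k := by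
  induction hg using Subgroup.closure_induction generalizing x with
  | mem g hg =>
    obtain ⟨i, h1, h2, hik, rfl⟩ := hg
    have := sRefl_cases h1 h2 x
    omega
  | one => rfl
  | mul g h _ _ ihg ihh => rw [Equiv.Perm.mul_apply, ihg, ihh]
  | inv g _ ih => rw [← ih, ← Equiv.Perm.mul_apply, mul_inv_cancel, Equiv.Perm.one_apply]

theorem descent_ne_of_stabilizes {m k i : ℕ} (hk : k ≤ m) (h1 : 1 ≤ i)
    {g : Equiv.Perm (Fin (2*m+2))} (hg : ∀ x : Fin (2*m+2), (g x : ℕ) < k ↔ (x : ℕ) < k)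
    (hd : g (fn m i) < g (fn m (i-1))) : i ≠ k := by
  rintro rfl
  have a := hg (fn m i)
  have b := hg (fn m (i-1))
  rw [fn_val (by omega)] at a b
  rw [Fin.lt_def] at hd
  omega

/-- The parabolic subgroup is the stabilizer of the set of the first `k` positions, and
it can be exhausted by length-increasing multiplications by its simple reflections. -/
theorem stabilizer_induction {m k : ℕ} (hk : k ≤ m) {P : Equiv.Perm (Fin (2*m+2)) → Prop}
    (one : P 1)
    (step : ∀ g i, g ∈ WP m k → 1 ≤ i → i ≤ m+1 → i ≠ k → g (fn m (i-1)) < g (fn m i) → P g →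
      P (g * sRefl m i))
    {g : Equiv.Perm (Fin (2*m+2))} (hW : g ∈ Weyl m)
    (hg : ∀ x : Fin (2*m+2), (g x : ℕ) < k ↔ (x : ℕ) < k) :
    g ∈ WP m k ∧ P g := by
  induction hN : len m g using Nat.strong_induction_on generalizing g with
  | _ N ih =>
    by_cases hg1 : g = 1
    · subst hg1; exact ⟨one_mem _, one⟩
    · obtain ⟨i, h1, h2, hd⟩ := exists_descent hW hg1
      have hik := descent_ne_of_stabilizes hk h1 hg hd
      have hs := sRefl_mem_WP h1 h2 hik
      obtain ⟨hm, hP⟩ := ih (len m (g * sRefl m i))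
        (by have := len_mul_sRefl_of_descent h1 h2 hW hd; omega)
        (mul_mem hW (sRefl_mem_Weyl h1 h2))
        (fun x => by rw [Equiv.Perm.mul_apply, hg, WP_apply_lt_iff hk hs]) rfl
      have hst := step _ i hm h1 h2 hik
        (by simpa only [Equiv.Perm.mul_apply, apply_sRefl_pred h1 h2, apply_sRefl_self h1 h2]
          using hd) hP
      have hmem := mul_mem hm hs
      rw [mul_sRefl_cancel h1 h2] at hst hmem
      exact ⟨hmem, hst⟩

theorem mem_WP_of_stabilizes {m k : ℕ} (hk : k ≤ m) {g : Equiv.Perm (Fin (2*m+2))}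
    (hW : g ∈ Weyl m) (hg : ∀ x : Fin (2*m+2), (x : ℕ) < k → (g x : ℕ) < k) : g ∈ WP m k := by
  refine (stabilizer_induction (P := fun _ => True) hk trivial (fun _ _ _ _ _ _ _ _ => trivial) hW
    fun x => ⟨fun h => ?_, hg x⟩).1
  obtain ⟨y, hy, hxy⟩ := Finset.surjOn_of_injOn_of_card_le
    (s := Finset.univ.filter fun x : Fin (2*m+2) => (x : ℕ) < k)
    (t := Finset.univ.filter fun x : Fin (2*m+2) => (x : ℕ) < k) g
    (by simpa [Set.MapsTo] using hg) g.injective.injOn le_rfl (by simpa using h)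
  rw [← g.injective hxy]
  simpa using hy

theorem isMinRep.ascent {m k i : ℕ} {w : Equiv.Perm (Fin (2*m+2))} (h : isMinRep m k w)
    (h1 : 1 ≤ i) (h2 : i ≤ m+1) (hik : i ≠ k) : w (fn m (i-1)) < w (fn m i) := by
  refine (ascent_or_descent h1 h2 w).resolve_right fun hd => ?_
  have a := h.2 _ (sRefl_mem_WP h1 h2 hik)
  have b := len_mul_sRefl_of_descent h1 h2 h.1 hd
  omega

theorem isMinRep.lt_of_le {m k : ℕ} {w : Equiv.Perm (Fin (2*m+2))} (h : isMinRep m k w) {x y : ℕ}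
    (hxy : x < y) (hy : y ≤ 2*m+1) (hb : y < k ∨ (k ≤ x ∧ y < 2*m+2-k)) :
    (w (fn m x) : ℕ) < w (fn m y) := by
  induction y, hxy using Nat.le_induction with
  | base =>
    change (w (fn m x) : ℕ) < w (fn m (x+1))
    by_cases hm : x ≤ m
    · exact h.ascent (i := x+1) (by omega) (by omega) (by omega)
    · have := h.ascent (i := 2*m+1-x) (by omega) (by omega) (by omega)
      have a1 := Weyl_val_of_add h.1 (x := fn m x) (y := fn m (2*m+1-x))
        (by rw [fn_val (by omega), fn_val (by omega)]; omega)
      have a2 := Weyl_val_of_add h.1 (x := fn m (x+1)) (y := fn m (2*m+1-x-1))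
        (by rw [fn_val (by omega), fn_val (by omega)]; omega)
      rw [Fin.lt_def] at this
      omega
  | succ y hxy ih =>
    refine (ih (by omega) (by omega)).trans ?_
    by_cases hm : y ≤ m
    · exact h.ascent (i := y+1) (by omega) (by omega) (by omega)
    · have := h.ascent (i := 2*m+1-y) (by omega) (by omega) (by omega)
      have a1 := Weyl_val_of_add h.1 (x := fn m y) (y := fn m (2*m+1-y))
        (by rw [fn_val (by omega), fn_val (by omega)]; omega)
      have a2 := Weyl_val_of_add h.1 (x := fn m (y+1)) (y := fn m (2*m+1-y-1))
        (by rw [fn_val (by omega), fn_val (by omega)]; omega)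
      rw [Fin.lt_def] at this
      omega

theorem isMinRep.lt_of_lt {m k : ℕ} {w : Equiv.Perm (Fin (2*m+2))} (h : isMinRep m k w)
    {x y : Fin (2*m+2)} (hxy : (x : ℕ) < y)
    (hb : (y : ℕ) < k ∨ (k ≤ (x : ℕ) ∧ (y : ℕ) < 2*m+2-k)) : (w x : ℕ) < w y := by
  have := h.lt_of_le hxy (by omega) hb
  rwa [fn_self, fn_self] at this

/-- In a minimal representative the positions `k+1, …, m+1` carry unbarred values. -/
theorem isMinRep.le_of_tail {m k : ℕ} {w : Equiv.Perm (Fin (2*m+2))} (h : isMinRep m k w)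
    {x : Fin (2*m+2)} (hk : k ≤ (x : ℕ)) (hx : (x : ℕ) ≤ m) : (w x : ℕ) ≤ m := by
  have e : (bar m x : ℕ) = 2*m+1-x := rfl
  have a := h.lt_of_lt (x := x) (y := bar m x) (by omega) (by omega)
  have b := Weyl_val h.1 x
  omega

theorem isMinRep.edges_mul {m k : ℕ} (hk : k ≤ m) {u g : Equiv.Perm (Fin (2*m+2))}
    (hu : isMinRep m k u) (hg : g ∈ WP m k) :
    Relation.ReflTransGen (BruhatEdge m) u (u * g) := by
  refine (stabilizer_induction (P := fun g => Relation.ReflTransGen (BruhatEdge m) u (u * g)) hk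
    (by rw [mul_one]) ?_ (WP_le_Weyl m k hg) (WP_apply_lt_iff hk hg)).2
  intro g i hg h1 h2 hik hasc ih
  refine ih.tail ?_
  have hst := WP_apply_lt_iff hk hg
  have hW := WP_le_Weyl m k hg
  have e1 : (fn m (i-1) : ℕ) = i-1 := fn_val (by omega)
  have e2 : (fn m i : ℕ) = i := fn_val (by omega)
  have a1 := hst (fn m (i-1))
  have a2 := hst (fn m i)
  have b := hst (bar m (fn m i))
  rw [Weyl_val hW, bar_val] at b
  refine ⟨fn m (i-1), fn m i, by rw [Fin.lt_def]; omega, ?_, ?_⟩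
  · exact hu.lt_of_lt hasc (by omega)
  · rw [pairRefl_eq_sRefl h1 h2 (Or.inl ⟨e1, e2⟩), mul_assoc]

theorem edges_mul_WP {m k : ℕ} (hk : k ≤ m) {g a b : Equiv.Perm (Fin (2*m+2))} (hg : g ∈ WP m k)
    (h : Relation.ReflTransGen (BruhatEdge m) a b) :
    ∃ g' ∈ WP m k, Relation.ReflTransGen (BruhatEdge m) (a * g') (b * g) := by
  refine (stabilizer_induction (P := fun g => ∃ g' ∈ WP m k,
    Relation.ReflTransGen (BruhatEdge m) (a * g') (b * g)) hk
    ⟨1, one_mem _, by simpa only [mul_one] using h⟩ ?_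
    (WP_le_Weyl m k hg) (WP_apply_lt_iff hk hg)).2
  rintro g i - h1 h2 hik - ⟨g', hg', ih⟩
  rw [← mul_assoc]
  rcases edges_mul_sRefl h1 h2 ih with ih | ih
  · exact ⟨g', hg', ih⟩
  · exact ⟨_, mul_mem hg' (sRefl_mem_WP h1 h2 hik), by rwa [← mul_assoc]⟩

/-- Bruhat comparison of cosets implies comparison of the minimal representatives. -/
theorem isMinRep.bruhatLE_of_edges {m k : ℕ} (hk : k ≤ m) {u w v : Equiv.Perm (Fin (2*m+2))}
    (hu : isMinRep m k u) (h : Relation.ReflTransGen (BruhatEdge m) u w)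
    (hwv : w⁻¹ * v ∈ WP m k) : bruhatLE m u v := by
  obtain ⟨g', hg', h'⟩ := edges_mul_WP hk hwv h
  rw [mul_inv_cancel_left] at h'
  exact OddSymplectic.bruhatLE_of_edges hu.1 ((hu.edges_mul hk hg').trans h')

theorem exists_isMinRep {m k : ℕ} {w : Equiv.Perm (Fin (2*m+2))} (hw : w ∈ Weyl m) :
    ∃ g ∈ WP m k, isMinRep m k (w * g) := by
  obtain ⟨g, hg, hmin⟩ := (Set.toFinite (WP m k : Set (Equiv.Perm (Fin (2*m+2))))).exists_minimalFor
    (fun g => len m (w * g)) _ ⟨1, one_mem _⟩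
  refine ⟨g, hg, mul_mem hw (WP_le_Weyl m k hg), fun v hv => ?_⟩
  rw [mul_assoc]
  exact le_of_not_gt fun hlt => (not_le_of_gt hlt) (hmin (mul_mem hg hv) hlt.le)

/-! ### Value sets -/

theorem mem_valSet {m k : ℕ} {w : Equiv.Perm (Fin (2*m+2))} {y : Fin (2*m+2)} :
    y ∈ valSet m k w ↔ ∃ x : Fin (2*m+2), (x : ℕ) < k ∧ w x = y := by
  simp [valSet]

theorem apply_mem_valSet {m k : ℕ} (w : Equiv.Perm (Fin (2*m+2))) {x : Fin (2*m+2)}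
    (hx : (x : ℕ) < k) : w x ∈ valSet m k w := mem_valSet.2 ⟨x, hx, rfl⟩

theorem card_filter_lt {m k : ℕ} (hk : k ≤ m) :
    (Finset.univ.filter fun x : Fin (2*m+2) => (x : ℕ) < k).card = k := by
  rw [Fin.card_filter_val_lt]
  omega

theorem card_valSet {m k : ℕ} (hk : k ≤ m) (w : Equiv.Perm (Fin (2*m+2))) :
    (valSet m k w).card = k := by
  rw [valSet, Finset.card_image_of_injective _ w.injective, card_filter_lt hk]

theorem mem_WP_of_valSet_subset {m k : ℕ} (hk : k ≤ m) {w v : Equiv.Perm (Fin (2*m+2))}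
    (hw : w ∈ Weyl m) (hv : v ∈ Weyl m) (h : valSet m k v ⊆ valSet m k w) : w⁻¹ * v ∈ WP m k := by
  refine mem_WP_of_stabilizes hk (mul_mem (inv_mem hw) hv) fun x hx => ?_
  obtain ⟨y, hy, hyx⟩ := mem_valSet.1 (h (apply_mem_valSet v hx))
  rwa [Equiv.Perm.mul_apply, ← hyx, ← Equiv.Perm.mul_apply, inv_mul_cancel, Equiv.Perm.one_apply]

theorem valSet_mul_WP {m k : ℕ} (hk : k ≤ m) (w : Equiv.Perm (Fin (2*m+2)))
    {g : Equiv.Perm (Fin (2*m+2))} (hg : g ∈ WP m k) : valSet m k (w * g) = valSet m k w := by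
  refine Finset.eq_of_subset_of_card_le (fun y hy => ?_) (by rw [card_valSet hk, card_valSet hk])
  obtain ⟨x, hx, rfl⟩ := mem_valSet.1 hy
  exact apply_mem_valSet w ((WP_apply_lt_iff hk hg x).2 hx)

theorem valSet_eq_of_cosetEq {m k : ℕ} (hk : k ≤ m) {v w : Equiv.Perm (Fin (2*m+2))}
    (h : cosetEq m k v w) : valSet m k v = valSet m k w := by
  rw [← valSet_mul_WP hk v h, mul_inv_cancel_left]

/-! ### The element `id_Y ·_k O^∘(d)` -/

/-- `w` is a signed permutation with one-line notation `f 0, …, f m`. -/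
def HasWindow (m : ℕ) (w : Equiv.Perm (Fin (2*m+2))) (f : ℕ → ℕ) : Prop :=
  w ∈ Weyl m ∧ ∀ j, j ≤ m → (w (fn m j) : ℕ) = f j

theorem HasWindow.congr {m : ℕ} {w : Equiv.Perm (Fin (2*m+2))} {f g : ℕ → ℕ}
    (h : HasWindow m w f) (hfg : ∀ j, j ≤ m → f j = g j) : HasWindow m w g :=
  ⟨h.1, fun j hj => (h.2 j hj).trans (hfg j hj)⟩

theorem HasWindow.hStepK_swap {m k i : ℕ} {w : Equiv.Perm (Fin (2*m+2))} {f g : ℕ → ℕ}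
    (h : HasWindow m w f) (h1 : 1 ≤ i) (h2 : i ≤ m) (hi : f (i-1) < f i ∨ i = k)
    (hg1 : g (i-1) = f i) (hg2 : g i = f (i-1))
    (hg : ∀ j, j ≤ m → j ≠ i-1 → j ≠ i → g j = f j) : HasWindow m (hStepK m k w i) g := by
  have hstep : hStepK m k w i = w * sRefl m i := by
    refine if_pos (hi.imp_left fun hlt => ?_)
    rw [len_mul_sRefl h1 (by omega) h.1]
    · omega
    · rwa [Fin.lt_def, h.2 _ (by omega), h.2 _ h2]
  rw [hstep]
  refine ⟨mul_mem h.1 (sRefl_mem_Weyl h1 (by omega)), fun j hj => ?_⟩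
  rw [Equiv.Perm.mul_apply]
  by_cases hj1 : j = i-1
  · rw [hj1, apply_sRefl_pred h1 (by omega), h.2 _ h2, hg1]
  by_cases hj2 : j = i
  · rw [hj2, apply_sRefl_self h1 (by omega), h.2 _ (by omega), hg2]
  rw [hg j hj hj1 hj2, ← h.2 j hj]
  congr 2
  have e : (fn m j : ℕ) = j := fn_val (by omega)
  have := sRefl_cases h1 (show i ≤ m+1 by omega) (fn m j)
  apply Fin.ext
  omega

theorem HasWindow.hStepK_of_descent {m k i : ℕ} {w : Equiv.Perm (Fin (2*m+2))} {f : ℕ → ℕ}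
    (h : HasWindow m w f) (h1 : 1 ≤ i) (h2 : i ≤ m) (hi : f i < f (i-1)) (hik : i ≠ k) :
    HasWindow m (hStepK m k w i) f := by
  have hstep : hStepK m k w i = w := by
    refine if_neg ?_
    have := len_mul_sRefl_of_descent h1 (by omega) h.1
      (by rwa [Fin.lt_def, h.2 _ h2, h.2 _ (by omega)])
    omega
  rwa [hstep]

theorem HasWindow.hStepK_last {m k : ℕ} {w : Equiv.Perm (Fin (2*m+2))} {f g : ℕ → ℕ}
    (h : HasWindow m w f) (hf : f m ≤ m) (hgm : g m = 2*m+1 - f m)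
    (hg : ∀ j, j < m → g j = f j) : HasWindow m (hStepK m k w (m+1)) g := by
  have h1 : 1 ≤ m+1 := by omega
  have e : (fn m m : ℕ) = m := fn_val (by omega)
  have e' : (fn m (m+1) : ℕ) = m+1 := fn_val (by omega)
  have hm := h.2 m le_rfl
  have hval := Weyl_val_of_add h.1 (x := fn m m) (y := fn m (m+1)) (by omega)
  have hstep : hStepK m k w (m+1) = w * sRefl m (m+1) := by
    refine if_pos (Or.inl ?_)
    rw [len_mul_sRefl h1 le_rfl h.1]
    · omega
    · rw [Fin.lt_def, Nat.add_sub_cancel]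
      omega
  rw [hstep]
  refine ⟨mul_mem h.1 (sRefl_mem_Weyl h1 le_rfl), fun j hj => ?_⟩
  rw [Equiv.Perm.mul_apply]
  by_cases hj1 : j = m
  · have := apply_sRefl_pred h1 (le_refl (m+1))
    rw [Nat.add_sub_cancel] at this
    rw [hj1, this, hgm]
    omega
  rw [hg j (by omega), ← h.2 j hj]
  congr 2
  have e : (fn m j : ℕ) = j := fn_val (by omega)
  have := sRefl_cases h1 (le_refl (m+1)) (fn m j)
  apply Fin.ext
  omega

/-- The one-line notation of `id_Y ·_k O^∘(d)`. -/
def ocircWindow (m k d j : ℕ) : ℕ :=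
  if j < d then 2*m-j else if j < k then j+1 else if j = k then 0 else j

/-- The one-line notation obtained from `ocircWindow m k d` by moving the entry at position `d`
to position `i` and changing its value to `v`. -/
def movedWindow (m k d i v j : ℕ) : ℕ :=
  if j < d then 2*m-j else if j < i then ocircWindow m k d (j+1) else if j = i then v else
    ocircWindow m k d j

theorem ocircWindow_cases (m k d j : ℕ) :
    (j < d ∧ ocircWindow m k d j = 2*m-j) ∨ (d ≤ j ∧ j < k ∧ ocircWindow m k d j = j+1) ∨
      (d ≤ j ∧ j = k ∧ ocircWindow m k d j = 0) ∨ (d ≤ j ∧ k < j ∧ ocircWindow m k d j = j) := by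
  unfold ocircWindow
  split_ifs <;> omega

theorem movedWindow_cases {d i : ℕ} (hdi : d ≤ i) (m k v j : ℕ) :
    (j < d ∧ movedWindow m k d i v j = 2*m-j) ∨
      (d ≤ j ∧ j < i ∧ movedWindow m k d i v j = ocircWindow m k d (j+1)) ∨
      (j = i ∧ movedWindow m k d i v j = v) ∨
      (i < j ∧ movedWindow m k d i v j = ocircWindow m k d j) := by
  unfold movedWindow
  split_ifs <;> omega

theorem HasWindow.foldl_ascending {m k d : ℕ} (hd : d < k) (hk : k ≤ m)
    {w : Equiv.Perm (Fin (2*m+2))} (h : HasWindow m w (ocircWindow m k d)) {i : ℕ} (hi : i ≤ m) :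
    HasWindow m ((List.range' 1 i).foldl (hStepK m k) w)
      (movedWindow m k d (max i d) (d+1)) := by
  induction i with
  | zero =>
    refine h.congr fun j hj => ?_
    have := movedWindow_cases (le_max_right 0 d) m k (d+1) j
    have := ocircWindow_cases m k d j
    omega
  | succ i ih =>
    have ih := ih (by omega)
    rw [List.range'_concat, List.foldl_append, one_mul, add_comm 1 i]
    by_cases hid : i + 1 ≤ d
    · rw [max_eq_right (by omega)] at ih ⊢
      refine ih.hStepK_of_descent (by omega) hi ?_ (by omega)
      have := movedWindow_cases (le_refl d) m k (d+1) (i+1)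
      have := movedWindow_cases (le_refl d) m k (d+1) i
      rw [Nat.add_sub_cancel]
      omega
    · rw [max_eq_left (by omega)] at ih ⊢
      have hi0 := movedWindow_cases (d := d) (i := i) (by omega) m k (d+1) i
      have hi1 := movedWindow_cases (d := d) (i := i) (by omega) m k (d+1) (i+1)
      have hi0' := movedWindow_cases (d := d) (i := i+1) (by omega) m k (d+1) i
      have hi1' := movedWindow_cases (d := d) (i := i+1) (by omega) m k (d+1) (i+1)
      have hc := ocircWindow_cases m k d (i+1)
      refine ih.hStepK_swap (by omega) hi ?_ ?_ ?_ fun j hj hj1 hj2 => ?_ <;>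
        rw [Nat.add_sub_cancel] at *
      · omega
      · omega
      · omega
      · have := movedWindow_cases (d := d) (i := i) (by omega) m k (d+1) j
        have := movedWindow_cases (d := d) (i := i+1) (by omega) m k (d+1) j
        omega

theorem HasWindow.foldl_descending {m k d : ℕ} (hd : d < k) (hk : k ≤ m) {i : ℕ} (hi : i ≤ m)
    {w : Equiv.Perm (Fin (2*m+2))} (h : HasWindow m w (movedWindow m k d (max i d) (2*m-d))) :
    HasWindow m ((List.range' 1 i).reverse.foldl (hStepK m k) w) (ocircWindow m k (d+1)) := by
  induction i generalizing w with
  | zero =>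
    refine h.congr fun j hj => ?_
    have := movedWindow_cases (le_max_right 0 d) m k (2*m-d) j
    have := ocircWindow_cases m k d j
    have := ocircWindow_cases m k (d+1) j
    omega
  | succ i ih =>
    rw [List.range'_concat, List.reverse_append, List.foldl_append, one_mul, add_comm 1 i]
    refine ih (by omega) ?_
    change HasWindow m (hStepK m k w (i+1)) _
    by_cases hid : i + 1 ≤ d
    · rw [max_eq_right (by omega)] at h ⊢
      refine h.hStepK_of_descent (by omega) hi ?_ (by omega)
      have := movedWindow_cases (le_refl d) m k (2*m-d) (i+1)
      have := movedWindow_cases (le_refl d) m k (2*m-d) i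
      rw [Nat.add_sub_cancel]
      omega
    · rw [max_eq_left (by omega)] at h ⊢
      have hi0 := movedWindow_cases (d := d) (i := i) (by omega) m k (2*m-d) i
      have hi1 := movedWindow_cases (d := d) (i := i) (by omega) m k (2*m-d) (i+1)
      have hi0' := movedWindow_cases (d := d) (i := i+1) (by omega) m k (2*m-d) i
      have hi1' := movedWindow_cases (d := d) (i := i+1) (by omega) m k (2*m-d) (i+1)
      have hc := ocircWindow_cases m k d (i+1)
      refine h.hStepK_swap (by omega) hi ?_ ?_ ?_ fun j hj hj1 hj2 => ?_ <;>
        rw [Nat.add_sub_cancel] at *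
      · omega
      · omega
      · omega
      · have := movedWindow_cases (d := d) (i := i) (by omega) m k (2*m-d) j
        have := movedWindow_cases (d := d) (i := i+1) (by omega) m k (2*m-d) j
        omega

theorem HasWindow.hWordK_wordOcirc1 {m k d : ℕ} (hd : d < k) (hk : k ≤ m)
    {w : Equiv.Perm (Fin (2*m+2))} (h : HasWindow m w (ocircWindow m k d)) :
    HasWindow m (hWordK m k w (wordOcirc1 m)) (ocircWindow m k (d+1)) := by
  unfold hWordK wordOcirc1 ascList
  rw [List.foldl_append, Nat.add_sub_cancel, Nat.add_sub_cancel, List.range'_concat,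
    List.foldl_append, one_mul, add_comm 1 m]
  refine HasWindow.foldl_descending hd hk le_rfl ?_
  have hup := h.foldl_ascending hd hk (le_refl m)
  rw [max_eq_left (by omega)] at hup ⊢
  refine hup.hStepK_last (g := movedWindow m k d m (2*m-d)) ?_ ?_ ?_
  · unfold movedWindow
    split_ifs <;> omega
  · unfold movedWindow
    split_ifs <;> omega
  · intro j hj
    unfold movedWindow
    split_ifs <;> omega

theorem HasWindow.mulOcirc {m k d : ℕ} (hd : d ≤ k) (hk : k ≤ m) {w : Equiv.Perm (Fin (2*m+2))}
    (h : HasWindow m w (ocircWindow m k 0)) :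
    HasWindow m (mulOcirc m k w d) (ocircWindow m k d) := by
  induction d with
  | zero => exact h
  | succ d ih =>
    have := (ih (by omega)).hWordK_wordOcirc1 (by omega) hk
    rwa [OddSymplectic.mulOcirc, wordOcirc, List.replicate_succ', List.flatten_append,
      List.flatten_singleton, hWordK, List.foldl_append]

/-- The set of values `{d+2, …, k+1, bar (d+1), …, bar 2}`. -/
def targetSet (m k d : ℕ) : Finset (Fin (2*m+2)) :=
  ((Finset.Icc (d+2) (k+1)).image (fun i => fn m (i-1))) ∪
    ((Finset.Icc 2 (d+1)).image (fun i => fn m (2*m+2-i)))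

theorem mem_targetSet {m k d : ℕ} (hd : d ≤ k) (hk : k ≤ m) {y : Fin (2*m+2)} :
    y ∈ targetSet m k d ↔
      (d+1 ≤ (y : ℕ) ∧ (y : ℕ) ≤ k) ∨ (2*m+1-d ≤ (y : ℕ) ∧ (y : ℕ) ≤ 2*m) := by
  simp only [targetSet, Finset.mem_union, Finset.mem_image, Finset.mem_Icc]
  constructor
  · rintro (⟨i, hi, rfl⟩ | ⟨i, hi, rfl⟩)
    · rw [fn_val (by omega)]; omega
    · rw [fn_val (by omega)]; omega
  · rintro (h | h)
    · exact Or.inl ⟨y+1, by omega, fn_self y⟩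
    · refine Or.inr ⟨2*m+2-y, by omega, ?_⟩
      rw [show 2*m+2-(2*m+2-(y : ℕ)) = y by omega, fn_self]

theorem valSet_eq_targetSet {m k d : ℕ} (hd : d ≤ k) (hk : k ≤ m) {w : Equiv.Perm (Fin (2*m+2))}
    (h : ∀ x : Fin (2*m+2), (x : ℕ) < k →
      (d+1 ≤ (w x : ℕ) ∧ (w x : ℕ) ≤ k) ∨ (2*m+1-d ≤ (w x : ℕ) ∧ (w x : ℕ) ≤ 2*m)) :
    valSet m k w = targetSet m k d := by
  refine Finset.eq_of_subset_of_card_le (fun y hy => ?_) ?_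
  · obtain ⟨x, hx, rfl⟩ := mem_valSet.1 hy
    exact (mem_targetSet hd hk).2 (h x hx)
  · rw [card_valSet hk]
    refine (Finset.card_union_le _ _).trans ((add_le_add Finset.card_image_le
      Finset.card_image_le).trans ?_)
    rw [Nat.card_Icc, Nat.card_Icc]
    omega

theorem HasWindow.valSet_eq {m k d : ℕ} (hd : d ≤ k) (hk : k ≤ m) {w : Equiv.Perm (Fin (2*m+2))}
    (h : HasWindow m w (ocircWindow m k d)) : valSet m k w = targetSet m k d := by
  refine valSet_eq_targetSet hd hk fun x hx => ?_
  have := h.2 x (by omega)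
  rw [fn_self] at this
  rw [this]
  unfold ocircWindow
  split_ifs <;> omega

/-- The minimal representative of `id_Y` has one-line notation `2, …, k+1, 1, k+2, …, m+1`. -/
theorem isMinRep.hasWindow {m k : ℕ} (hk : k ≤ m) {u : Equiv.Perm (Fin (2*m+2))}
    (hu : isMinRep m k u) (hval : valSet m k u = targetSet m k 0) :
    HasWindow m u (ocircWindow m k 0) := by
  have hmem : ∀ y : Fin (2*m+2), y ∈ valSet m k u ↔ 1 ≤ (y : ℕ) ∧ (y : ℕ) ≤ k := by
    intro y
    rw [hval, mem_targetSet (Nat.zero_le k) hk]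
    omega
  have hhead : ∀ j, j < k → 1 ≤ (u (fn m j) : ℕ) ∧ (u (fn m j) : ℕ) ≤ k := fun j hj =>
    (hmem _).1 (apply_mem_valSet u (by rwa [fn_val (by omega)]))
  have htail : ∀ j, k ≤ j → j ≤ m →
      (u (fn m j) : ℕ) ≤ m ∧ ¬ (1 ≤ (u (fn m j) : ℕ) ∧ (u (fn m j) : ℕ) ≤ k) := by
    intro j hj hjm
    have e : (fn m j : ℕ) = j := fn_val (by omega)
    refine ⟨hu.le_of_tail (by omega) (by omega), fun hc => ?_⟩
    obtain ⟨x, hx, hxj⟩ := mem_valSet.1 ((hmem _).2 hc)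
    have := u.injective hxj
    rw [Fin.ext_iff] at this
    omega
  have hlow : ∀ j, j < k → j + 1 ≤ (u (fn m j) : ℕ) := by
    intro j hj
    induction j with
    | zero => exact (hhead 0 hj).1
    | succ j ih =>
      have := hu.lt_of_le (x := j) (y := j+1) (by omega) (by omega) (by omega)
      have := ih (by omega)
      omega
  have hhigh : ∀ i, i < k → (u (fn m (k-1-i)) : ℕ) ≤ k-i := by
    intro i hi
    induction i with
    | zero => exact (hhead _ (by omega)).2
    | succ i ih =>
      have := hu.lt_of_le (x := k-1-(i+1)) (y := k-1-i) (by omega) (by omega) (by omega)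
      have := ih (by omega)
      omega
  have tlow : ∀ i, k + 1 + i ≤ m → k + 1 + i ≤ (u (fn m (k+1+i)) : ℕ) := by
    intro i hi
    induction i with
    | zero =>
      have := hu.lt_of_le (x := k) (y := k+1) (by omega) (by omega) (by omega)
      have := htail (k+1+0) (by omega) hi
      simp only [add_zero] at this ⊢
      omega
    | succ i ih =>
      have := hu.lt_of_le (x := k+1+i) (y := k+1+(i+1)) (by omega) (by omega) (by omega)
      have := ih (by omega)
      omega
  have thigh : ∀ i, k + i ≤ m → (u (fn m (m-i)) : ℕ) ≤ m-i := by
    intro i hi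
    induction i with
    | zero => exact (htail m (by omega) le_rfl).1
    | succ i ih =>
      have := hu.lt_of_le (x := m-(i+1)) (y := m-i) (by omega) (by omega) (by omega)
      have := ih (by omega)
      omega
  refine ⟨hu.1, fun j hj => ?_⟩
  rcases lt_trichotomy j k with h | rfl | h
  · have a := hlow j h
    have b := hhigh (k-1-j) (by omega)
    rw [show k-1-(k-1-j) = j by omega] at b
    unfold ocircWindow
    split_ifs <;> omega
  · have a := htail j le_rfl hj
    have b := thigh (m-j) (by omega)
    rw [show m-(m-j) = j by omega] at b
    unfold ocircWindow
    split_ifs <;> omega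
  · have a := tlow (j-(k+1)) (by omega)
    have b := thigh (m-j) (by omega)
    rw [show m-(m-j) = j by omega] at b
    rw [show k+1+(j-(k+1)) = j by omega] at a
    unfold ocircWindow
    split_ifs <;> omega


/-! ### A chain from `id_Y` to `id_Y ·_k O^∘(d)` -/

theorem ChainO.snoc {m k d : ℕ} {u v w : Equiv.Perm (Fin (2*m+2))} (h : ChainO m k u v d)
    (a : PosRoot) (ha : a.valid m) (hr : a.rootCoeff m k ≠ 0) (hw : isMinRep m k w)
    (ho : isOdd m w) (hc : cosetEq m k w (v * a.refl m)) :
    ChainO m k u w (d + a.corootCoeff k) := by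
  induction h with
  | nil u =>
    rw [add_comm]
    exact .cons a w ha hr hw ho hc (.nil w)
  | cons b x hb hbr hx hxo hxc _ ih =>
    rw [add_assoc]
    exact .cons b x hb hbr hx hxo hxc (ih hc)

theorem refl_lg_eq_pairRefl {m : ℕ} {x : Fin (2*m+2)} :
    (PosRoot.lg (x+1)).refl m = pairRefl m x (bar m x) := by
  rw [pairRefl, if_pos rfl, PosRoot.refl, Nat.add_sub_cancel, fn_self]
  congr 1
  apply Fin.ext
  rw [fn_val (by omega), bar_val]
  omega

theorem isMinRep.isOdd_of_valSet {m k d : ℕ} (hd : d ≤ k) (hk : k ≤ m)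
    {v : Equiv.Perm (Fin (2*m+2))} (hv : isMinRep m k v) (h : valSet m k v = targetSet m k d) :
    isOdd m v := by
  intro x hx hvx
  rw [Fin.ext_iff, fn_val (by omega)] at hvx
  by_cases hxk : (x : ℕ) < k
  · have := (mem_targetSet hd hk).1 (h ▸ apply_mem_valSet v hxk)
    omega
  · have := hv.le_of_tail (not_lt.1 hxk) hx
    omega

theorem ChainO.snoc_targetSet {m k e : ℕ} (he : e < k) (hk : k ≤ m)
    {u v v' : Equiv.Perm (Fin (2*m+2))} (h : ChainO m k u v e) (hv : v ∈ Weyl m)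
    (hval : valSet m k v = targetSet m k e) (hv' : isMinRep m k v')
    (hval' : valSet m k v' = targetSet m k (e+1)) : ChainO m k u v' (e+1) := by
  have hmem : fn m (e+1) ∈ valSet m k v := by
    rw [hval, mem_targetSet he.le hk, fn_val (by omega)]
    omega
  obtain ⟨x, hx, hvx⟩ := mem_valSet.1 hmem
  rw [Fin.ext_iff, fn_val (by omega)] at hvx
  have hcoeff : (PosRoot.lg (x+1)).corootCoeff k = 1 := if_pos hx
  have hroot : (PosRoot.lg (x+1)).rootCoeff m k ≠ 0 := by
    rw [PosRoot.rootCoeff, if_pos ⟨hx, hk⟩]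
    exact two_ne_zero
  rw [← hcoeff]
  refine h.snoc _ ⟨by omega, by omega⟩ hroot hv' (hv'.isOdd_of_valSet he hk hval') ?_
  rw [refl_lg_eq_pairRefl]
  refine mem_WP_of_valSet_subset hk hv'.1 (mul_mem hv (pairRefl_mem_Weyl _ _)) ?_
  rw [hval']
  refine (valSet_eq_targetSet he hk fun y hy => ?_).subset
  rw [Equiv.Perm.mul_apply]
  have hb : (bar m x : ℕ) = 2*m+1-x := bar_val m x
  have hvb := Weyl_val hv x
  rcases pairRefl_cases x (bar m x) y with h | h | h | h | ⟨hyx, -, -, -, h⟩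
  · rw [Fin.ext h.2]
    omega
  · omega
  · omega
  · rw [Fin.ext (show (pairRefl m x (bar m x) y : ℕ) = bar m x by omega)]
    omega
  · rw [Fin.ext h]
    have hmy := (mem_targetSet he.le hk).1 (hval ▸ apply_mem_valSet v hy)
    have hne : (v y : ℕ) ≠ v x := fun e => hyx (congrArg _ (v.injective (Fin.ext e)))
    omega

theorem exists_chainO_targetSet {m k d : ℕ} (hd : d ≤ k) (hk : k ≤ m)
    {u : Equiv.Perm (Fin (2*m+2))} (hu : isMinRep m k u) (hval : valSet m k u = targetSet m k 0) :
    ∃ v, isMinRep m k v ∧ valSet m k v = targetSet m k d ∧ ChainO m k u v d := by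
  induction d with
  | zero => exact ⟨u, hu, hval, .nil u⟩
  | succ d ih =>
    obtain ⟨v, hv, hvval, hch⟩ := ih (by omega)
    have hwin := (hu.hasWindow hk hval).mulOcirc hd hk
    obtain ⟨g, hg, hmin⟩ := exists_isMinRep (k := k) hwin.1
    have hval' := (valSet_mul_WP hk _ hg).trans (hwin.valSet_eq hd hk)
    exact ⟨_, hmin, hval', hch.snoc_targetSet hd hk hv.1 hvval hmin hval'⟩

/-! ### Chains and the number of entries outside `{2, …, k+1}` -/

/-- The first `k` positions whose entry is not one of `2, …, k+1`. -/
def movedSet (m k : ℕ) (w : Equiv.Perm (Fin (2*m+2))) : Finset (Fin (2*m+2)) :=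
  Finset.univ.filter fun x => (x : ℕ) < k ∧ ¬ (1 ≤ (w x : ℕ) ∧ (w x : ℕ) ≤ k)

theorem mem_movedSet {m k : ℕ} {w : Equiv.Perm (Fin (2*m+2))} {x : Fin (2*m+2)} :
    x ∈ movedSet m k w ↔ (x : ℕ) < k ∧ ¬ (1 ≤ (w x : ℕ) ∧ (w x : ℕ) ≤ k) := by
  simp [movedSet]

theorem card_movedSet_eq_of_valSet_eq {m k : ℕ} {v w : Equiv.Perm (Fin (2*m+2))}
    (h : valSet m k v = valSet m k w) : (movedSet m k v).card = (movedSet m k w).card := by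
  have key : ∀ w : Equiv.Perm (Fin (2*m+2)), (movedSet m k w).card =
      ((valSet m k w).filter fun y : Fin (2*m+2) => ¬ (1 ≤ (y : ℕ) ∧ (y : ℕ) ≤ k)).card := by
    intro w
    rw [valSet, Finset.filter_image, Finset.card_image_of_injective _ w.injective,
      Finset.filter_filter, movedSet]
  rw [key, key, h]

theorem card_movedSet_mul_le {m k : ℕ} (w r : Equiv.Perm (Fin (2*m+2)))
    {s : Finset (Fin (2*m+2))} (h : ∀ x : Fin (2*m+2), (x : ℕ) < k → x ∉ s → (r x : ℕ) = x) :
    (movedSet m k (w * r)).card ≤ (movedSet m k w).card + s.card := by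
  refine (Finset.card_le_card fun x hx => ?_).trans (Finset.card_union_le _ _)
  rw [mem_movedSet, Equiv.Perm.mul_apply] at hx
  rw [Finset.mem_union, mem_movedSet]
  by_cases hs : x ∈ s
  · exact Or.inr hs
  · rw [Fin.ext (h x hx.1 hs)] at hx
    exact Or.inl hx

theorem card_movedSet_mul_refl_le {m k : ℕ} (hk : k ≤ m) (w : Equiv.Perm (Fin (2*m+2)))
    {a : PosRoot} (ha : a.valid m) (hr : a.rootCoeff m k ≠ 0) :
    (movedSet m k (w * a.refl m)).card ≤ (movedSet m k w).card + a.corootCoeff k := by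
  have hnot : ∀ {x : Fin (2*m+2)} {i : ℕ}, i < 2*m+2 → x ∉ ({fn m i} : Finset _) →
      (x : ℕ) ≠ i := by
    intro x i hi hx e
    exact hx (Finset.mem_singleton.2 (Fin.ext (e.trans (fn_val hi).symm)))
  cases a with
  | tm i j =>
    obtain ⟨h1, h2, h3⟩ := ha
    have hij : i ≤ k ∧ k < j := by
      by_contra hc
      exact hr (if_neg hc)
    rw [PosRoot.corootCoeff, if_pos hij]
    refine card_movedSet_mul_le w _ (s := {fn m (i-1)}) fun x hx hxs => ?_
    have hxi := hnot (by omega) hxs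
    rw [PosRoot.refl, Equiv.Perm.mul_apply]
    have a := swap_cases (fn m (2*m+2-i)) (fn m (2*m+2-j)) x
    have b := swap_cases (fn m (i-1)) (fn m (j-1))
      (Equiv.swap (fn m (2*m+2-i)) (fn m (2*m+2-j)) x)
    simp only [fn_val (show i-1 < 2*m+2 by omega), fn_val (show j-1 < 2*m+2 by omega),
      fn_val (show 2*m+2-i < 2*m+2 by omega), fn_val (show 2*m+2-j < 2*m+2 by omega)] at a b
    omega
  | tp i j =>
    obtain ⟨h1, h2, h3⟩ := ha
    have hswap : ∀ x : Fin (2*m+2), (x : ℕ) < k → (x : ℕ) ≠ i-1 → (x : ℕ) ≠ j-1 →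
        ((PosRoot.tp i j).refl m x : ℕ) = x := by
      intro x hx hxi hxj
      rw [PosRoot.refl, Equiv.Perm.mul_apply]
      have a := swap_cases (fn m (j-1)) (fn m (2*m+2-i)) x
      have b := swap_cases (fn m (i-1)) (fn m (2*m+2-j))
        (Equiv.swap (fn m (j-1)) (fn m (2*m+2-i)) x)
      simp only [fn_val (show i-1 < 2*m+2 by omega), fn_val (show j-1 < 2*m+2 by omega),
        fn_val (show 2*m+2-i < 2*m+2 by omega), fn_val (show 2*m+2-j < 2*m+2 by omega)] at a b
      omega
    by_cases hij : i ≤ k ∧ k < j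
    · rw [PosRoot.corootCoeff, if_pos hij]
      exact card_movedSet_mul_le w _ (s := {fn m (i-1)}) fun x hx hxs =>
        hswap x hx (hnot (by omega) hxs) (by omega)
    · have hj : j ≤ k := by
        by_contra hc
        refine hr ?_
        rw [PosRoot.rootCoeff, if_neg hij, if_neg (by omega), if_neg hc]
      rw [PosRoot.corootCoeff, if_neg hij, if_pos hj]
      refine (card_movedSet_mul_le w _ (s := {fn m (i-1), fn m (j-1)}) fun x hx hxs => ?_).trans
        (Nat.add_le_add_left Finset.card_le_two _)
      rw [Finset.mem_insert, not_or, ← Finset.mem_singleton] at hxs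
      exact hswap x hx (hnot (by omega) hxs.1) (hnot (by omega) hxs.2)
  | lg i =>
    obtain ⟨h1, h2⟩ := ha
    have hi : i ≤ k := by
      by_contra hc
      refine hr ?_
      rw [PosRoot.rootCoeff, if_neg (by omega), if_neg hc]
    rw [PosRoot.corootCoeff, if_pos hi]
    refine card_movedSet_mul_le w _ (s := {fn m (i-1)}) fun x hx hxs => ?_
    have hxi := hnot (by omega) hxs
    have a := swap_cases (fn m (i-1)) (fn m (2*m+2-i)) x
    simp only [fn_val (show i-1 < 2*m+2 by omega), fn_val (show 2*m+2-i < 2*m+2 by omega)] at a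
    rw [PosRoot.refl]
    omega

theorem ChainO.card_movedSet_le {m k d : ℕ} (hk : k ≤ m) {u v : Equiv.Perm (Fin (2*m+2))}
    (h : ChainO m k u v d) : (movedSet m k v).card ≤ (movedSet m k u).card + d := by
  induction h with
  | nil u => exact le_rfl
  | cons a v ha hr _ _ hc _ ih =>
    rw [card_movedSet_eq_of_valSet_eq (valSet_eq_of_cosetEq hk hc)] at ih
    exact ih.trans ((Nat.add_le_add_right (card_movedSet_mul_refl_le hk _ ha hr) _).trans_eq
      (add_assoc _ _ _))

/-! ### The Bruhat bound -/

/-- `w` has at most `d` of its first `k` entries outside `{2, …, k+1}`, and none of them is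
`1` or `bar 1`. -/
def IsAdmissible (m k d : ℕ) (w : Equiv.Perm (Fin (2*m+2))) : Prop :=
  (∀ x : Fin (2*m+2), (x : ℕ) < k → 1 ≤ (w x : ℕ) ∧ (w x : ℕ) ≤ 2*m) ∧ (movedSet m k w).card ≤ d

theorem IsAdmissible.mul {m k d : ℕ} {w r : Equiv.Perm (Fin (2*m+2))} (h : IsAdmissible m k d w)
    (hr : ∀ x : Fin (2*m+2), (x : ℕ) < k → (r x : ℕ) = x ∨
      (1 ≤ (w (r x) : ℕ) ∧ (w (r x) : ℕ) ≤ 2*m ∧ (x ∈ movedSet m k w ∨ (w (r x) : ℕ) ≤ k))) :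
    IsAdmissible m k d (w * r) := by
  refine ⟨fun x hx => ?_, (Finset.card_le_card fun x hx => ?_).trans h.2⟩
  · rw [Equiv.Perm.mul_apply]
    rcases hr x hx with e | e
    · rw [Fin.ext e]
      exact h.1 x hx
    · exact ⟨e.1, e.2.1⟩
  · rw [mem_movedSet, Equiv.Perm.mul_apply] at hx
    rcases hr x hx.1 with e | e
    · rwa [Fin.ext e, ← mem_movedSet] at hx
    · exact e.2.2.resolve_right fun e' => hx.2 ⟨e.1, e'⟩

/-- No admissible signed permutation is obtained from `w` by a `BruhatEdge`. -/
def IsEdgeMaximal (m k d : ℕ) (w : Equiv.Perm (Fin (2*m+2))) : Prop :=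
  w ∈ Weyl m ∧ IsAdmissible m k d w ∧ ∀ w', BruhatEdge m w w' → ¬ IsAdmissible m k d w'

theorem exists_isEdgeMaximal {m k d : ℕ} {u : Equiv.Perm (Fin (2*m+2))} (hu : u ∈ Weyl m)
    (h : IsAdmissible m k d u) :
    ∃ w, Relation.ReflTransGen (BruhatEdge m) u w ∧ IsEdgeMaximal m k d w := by
  obtain ⟨w, ⟨huw, hw, hadm⟩, hmax⟩ := (Set.toFinite {w | Relation.ReflTransGen (BruhatEdge m) u w ∧
    w ∈ Weyl m ∧ IsAdmissible m k d w}).exists_maximalFor (len m) _ ⟨u, .refl, hu, h⟩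
  refine ⟨w, huw, hw, hadm, fun w' hww' hadm' => ?_⟩
  obtain ⟨-, -, -, hlt⟩ := hww'.exists_reflection hw
  exact (not_le_of_gt hlt) (hmax ⟨huw.tail hww', hww'.mem_Weyl hw, hadm'⟩ hlt.le)

section

variable {m k d : ℕ} {w : Equiv.Perm (Fin (2*m+2))}

theorem IsEdgeMaximal.unbarred_le (hk : k ≤ m) (h : IsEdgeMaximal m k d w) {x : Fin (2*m+2)}
    (hx : (x : ℕ) < k) (hwx : (w x : ℕ) ≤ m) : (w x : ℕ) ≤ k := by
  by_contra! hlt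
  have hb : (bar m x : ℕ) = 2*m+1-x := bar_val m x
  have hv := Weyl_val h.1 x
  refine h.2.2 _ ⟨x, bar m x, Fin.lt_def.2 (by omega), Fin.lt_def.2 (by omega), rfl⟩
    (h.2.1.mul fun y hy => ?_)
  have hc := pairRefl_cases x (bar m x) y
  by_cases hyx : (y : ℕ) = x
  · obtain rfl := Fin.ext hyx
    rw [pairRefl_left, mem_movedSet]
    omega
  · omega

theorem IsEdgeMaximal.card_movedSet (hd : d ≤ k) (hk : k ≤ m) (h : IsEdgeMaximal m k d w) :
    (movedSet m k w).card = d := by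
  refine h.2.1.2.eq_of_not_lt fun hlt => ?_
  obtain ⟨x, hx, hxw⟩ := Finset.exists_mem_notMem_of_card_lt_card
    (s := movedSet m k w) (t := Finset.univ.filter fun x : Fin (2*m+2) => (x : ℕ) < k)
    (by rw [card_filter_lt hk]; omega)
  rw [Finset.mem_filter_univ] at hx
  rw [mem_movedSet, not_and, not_not] at hxw
  have hxw := hxw hx
  have hb : (bar m x : ℕ) = 2*m+1-x := bar_val m x
  have hv := Weyl_val h.1 x
  refine h.2.2 _ ⟨x, bar m x, Fin.lt_def.2 (by omega), Fin.lt_def.2 (by omega), rfl⟩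
    ⟨fun y hy => ?_, ?_⟩
  · rw [Equiv.Perm.mul_apply]
    have hc := pairRefl_cases x (bar m x) y
    by_cases hyx : (y : ℕ) = x
    · obtain rfl := Fin.ext hyx
      rw [pairRefl_left]
      omega
    · rw [Fin.ext (show (pairRefl m x (bar m x) y : ℕ) = y by omega)]
      exact h.2.1.1 y hy
  · refine (card_movedSet_mul_le w _ (s := {x}) fun y hy hyx => ?_).trans (by simpa using hlt)
    have hc := pairRefl_cases x (bar m x) y
    rw [Finset.mem_singleton, Fin.ext_iff] at hyx
    omega

theorem IsEdgeMaximal.barred_le (hk : k ≤ m) (h : IsEdgeMaximal m k d w) {y : Fin (2*m+2)}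
    (hy : y ∈ movedSet m k w) : 2*m+1-k ≤ (w y : ℕ) := by
  by_contra! hlt
  have hy' := mem_movedSet.1 hy
  have hyk := hy'.1
  have h1 := h.2.1.1 y hyk
  have h2 := h.unbarred_le hk hyk
  obtain ⟨t, ht, hts⟩ := Finset.exists_mem_notMem_of_card_lt_card
    (s := ((Finset.univ.filter fun x : Fin (2*m+2) => (x : ℕ) < k).erase y).image
      fun x => min (w x : ℕ) (2*m+1-w x)) (t := Finset.Icc 1 k) (by
        refine Finset.card_image_le.trans_lt ?_
        rw [Finset.card_erase_of_mem (by simpa using hyk), card_filter_lt hk, Nat.card_Icc]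
        omega)
  rw [Finset.mem_Icc] at ht
  have hmiss : ∀ x : Fin (2*m+2), (x : ℕ) < k → (w x : ℕ) ≠ t ∧ (w x : ℕ) + t ≠ 2*m+1 := by
    intro x hx
    by_cases hxy : x = y
    · subst hxy
      omega
    · have : min (w x : ℕ) (2*m+1-w x) ≠ t := fun e =>
        hts (Finset.mem_image.2 ⟨x, by simp [hxy, hx], e⟩)
      omega
  obtain ⟨l, hl⟩ := w.surjective (fn m (2*m+1-t))
  rw [Fin.ext_iff, fn_val (by omega)] at hl
  have hlk : ¬ (l : ℕ) < k := fun hlk => (hmiss l hlk).2 (by omega)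
  have hlk' : ¬ 2*m+1-(l : ℕ) < k := by
    intro hlk'
    have hb : (bar m l : ℕ) = 2*m+1-l := bar_val m l
    have := (hmiss (bar m l) (by omega)).1
    have := Weyl_val h.1 l
    omega
  refine h.2.2 _ ⟨y, l, Fin.lt_def.2 (by omega), Fin.lt_def.2 (by omega), rfl⟩
    (h.2.1.mul fun x hx => ?_)
  have hc := pairRefl_cases y l x
  by_cases hxy : (x : ℕ) = y
  · obtain rfl := Fin.ext hxy
    rw [pairRefl_left]
    exact Or.inr ⟨by omega, by omega, Or.inl hy⟩
  · omega

theorem IsEdgeMaximal.le_of_notMem (hk : k ≤ m) (h : IsEdgeMaximal m k d w) {x y : Fin (2*m+2)}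
    (hx : (x : ℕ) < k) (hxw : x ∉ movedSet m k w) (hy : y ∈ movedSet m k w) :
    2*m+1-(w y : ℕ) ≤ w x := by
  by_contra! hlt
  have hxy : (x : ℕ) ≠ y := fun e => hxw (Fin.ext e ▸ hy)
  have hyk := (mem_movedSet.1 hy).1
  have hb := h.barred_le hk hy
  have hby : (bar m y : ℕ) = 2*m+1-y := bar_val m y
  have hbx : (bar m x : ℕ) = 2*m+1-x := bar_val m x
  have hvy := Weyl_val h.1 y
  have hvx := Weyl_val h.1 x
  have hx1 := h.2.1.1 x hx
  refine h.2.2 _ ⟨x, bar m y, Fin.lt_def.2 (by omega), Fin.lt_def.2 (by omega), rfl⟩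
    (h.2.1.mul fun z hz => ?_)
  have hc := pairRefl_cases x (bar m y) z
  by_cases hzx : (z : ℕ) = x
  · obtain rfl := Fin.ext hzx
    rw [pairRefl_left]
    omega
  by_cases hzy : (z : ℕ) = y
  · obtain rfl := Fin.ext hzy
    rw [Fin.ext (show (pairRefl m x (bar m z) z : ℕ) = bar m x by omega)]
    exact Or.inr ⟨by omega, by omega, Or.inl hy⟩
  · omega

theorem IsEdgeMaximal.valSet_eq (hd : d ≤ k) (hk : k ≤ m) (h : IsEdgeMaximal m k d w) :
    valSet m k w = targetSet m k d := by
  let A : Fin (2*m+2) → ℕ := fun x => min (w x : ℕ) (2*m+1-w x)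
  have hA : ∀ x, A x = min (w x : ℕ) (2*m+1-w x) := fun _ => rfl
  have hgood : ∀ x : Fin (2*m+2), (x : ℕ) < k → x ∉ movedSet m k w →
      1 ≤ (w x : ℕ) ∧ (w x : ℕ) ≤ k := fun x hx hxw => by
    rw [mem_movedSet] at hxw
    tauto
  have hmaps : ∀ x : Fin (2*m+2), (x : ℕ) < k → 1 ≤ A x ∧ A x ≤ k := by
    intro x hx
    rw [hA]
    have := h.2.1.1 x hx
    by_cases hxw : x ∈ movedSet m k w
    · have := h.barred_le hk hxw
      omega
    · have := hgood x hx hxw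
      omega
  have hinj : ∀ x y : Fin (2*m+2), (x : ℕ) < k → (y : ℕ) < k → A x = A y → x = y := by
    intro x y hx hy hxy
    rw [hA, hA] at hxy
    by_cases hw : (w x : ℕ) = w y
    · exact w.injective (Fin.ext hw)
    · have hv := Weyl_val h.1 y
      have hb : (bar m y : ℕ) = 2*m+1-y := bar_val m y
      have := congrArg Fin.val (w.injective (Fin.ext (show (w x : ℕ) = w (bar m y) by omega)))
      omega
  have hsurj : ∀ t, 1 ≤ t → t ≤ k → ∃ x : Fin (2*m+2), (x : ℕ) < k ∧ A x = t := by
    intro t h1 h2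
    obtain ⟨x, hx, hxt⟩ := Finset.surjOn_of_injOn_of_card_le
      (s := Finset.univ.filter fun x : Fin (2*m+2) => (x : ℕ) < k) (t := Finset.Icc 1 k) A
      (fun x hx => by simpa using hmaps x (by simpa using hx))
      (fun x hx y hy hxy => hinj x y (by simpa using hx) (by simpa using hy) hxy)
      (by rw [card_filter_lt hk, Nat.card_Icc]; omega) (by simpa using ⟨h1, h2⟩)
    exact ⟨x, by simpa using hx, hxt⟩
  have hcard : ((movedSet m k w).image A).card = d := by
    rw [Finset.card_image_of_injOn, h.card_movedSet hd hk]
    exact fun x hx y hy hxy => hinj x y (mem_movedSet.1 hx).1 (mem_movedSet.1 hy).1 hxy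
  have hbad : ∀ y ∈ movedSet m k w, A y ≤ d := by
    intro y hy
    have hyk := (mem_movedSet.1 hy).1
    rw [← hcard]
    refine le_of_eq_of_le (by simp) (Finset.card_le_card (s := Finset.Icc 1 (A y)) fun t ht => ?_)
    rw [Finset.mem_Icc] at ht
    obtain ⟨x, hx, hxt⟩ := hsurj t ht.1 (ht.2.trans (hmaps y hyk).2)
    refine Finset.mem_image.2 ⟨x, by_contra fun hxw => ?_, hxt⟩
    have h1 := h.le_of_notMem hk hx hxw hy
    have h2 := h.barred_le hk hy
    have h3 := hgood x hx hxw
    have h4 := hA x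
    have h5 := hA y
    exact hxw (hinj x y hx hyk (by omega) ▸ hy)
  have himage : (movedSet m k w).image A = Finset.Icc 1 d := by
    refine Finset.eq_of_subset_of_card_le (fun t ht => ?_) (by rw [hcard, Nat.card_Icc]; omega)
    obtain ⟨y, hy, rfl⟩ := Finset.mem_image.1 ht
    exact Finset.mem_Icc.2 ⟨(hmaps y (mem_movedSet.1 hy).1).1, hbad y hy⟩
  refine valSet_eq_targetSet hd hk fun x hx => ?_
  have hx1 := hmaps x hx
  have hAx := hA x
  by_cases hxw : x ∈ movedSet m k w
  · have := hbad x hxw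
    have := h.barred_le hk hxw
    omega
  · have hg := hgood x hx hxw
    have : d < A x := by
      by_contra! hle
      obtain ⟨y, hy, hyx⟩ := Finset.mem_image.1
        (himage.symm ▸ Finset.mem_Icc.2 ⟨hx1.1, hle⟩ : A x ∈ (movedSet m k w).image A)
      exact hxw (hinj y x (mem_movedSet.1 hy).1 hx hyx ▸ hy)
    omega

end

theorem isMinRep.bruhatLE_of_isAdmissible {m k d : ℕ} (hd : d ≤ k) (hk : k ≤ m)
    {u v : Equiv.Perm (Fin (2*m+2))} (hu : isMinRep m k u) (hadm : IsAdmissible m k d u)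
    (hv : v ∈ Weyl m) (hval : valSet m k v = targetSet m k d) : bruhatLE m u v := by
  obtain ⟨w, huw, hw⟩ := exists_isEdgeMaximal hu.1 hadm
  exact hu.bruhatLE_of_edges hk huw
    (mem_WP_of_valSet_subset hk hw.1 hv (hval.trans (hw.valSet_eq hd hk).symm).subset)

theorem ChainO.isAdmissible {m k d : ℕ} (hk : k ≤ m) {u v : Equiv.Perm (Fin (2*m+2))}
    (hval : valSet m k u = targetSet m k 0) (hv : isMinRep m k v) (hodd : isOdd m v)
    (h0 : v (fn m 0) ≠ fn m 0) (h : ChainO m k u v d) : IsAdmissible m k d v := by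
  rw [ne_eq, Fin.ext_iff, fn_val (by omega : 0 < 2*m+2)] at h0
  refine ⟨fun x hx => ?_, ?_⟩
  · have h1 := hodd x (by omega)
    rw [ne_eq, Fin.ext_iff, fn_val (by omega)] at h1
    by_cases hx0 : (x : ℕ) = 0
    · rw [← hx0, fn_self] at h0
      omega
    · have := hv.lt_of_le (x := 0) (y := x) (by omega) (by omega) (by omega)
      rw [fn_self] at this
      omega
  · have hu : movedSet m k u = ∅ := by
      refine Finset.eq_empty_of_forall_notMem fun x hx => ?_
      rw [mem_movedSet] at hx
      have := (mem_targetSet (Nat.zero_le k) hk).1 (hval ▸ apply_mem_valSet u hx.1)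
      omega
    have := h.card_movedSet_le hk
    rwa [hu, Finset.card_empty, zero_add] at this

/-- For `1 ≤ d ≤ k < n+1`, the set `A_Y(d)` of `u ∈ W^P ∩ W^{odd}`
with `u(1) ≠ 1` joined to `id_Y W_P` by a degree `d` chain in the moment graph of
`IG(k, 2n+1)` has a Bruhat-maximal element, namely the minimal length representative
`vd` of `id_Y ·_k O^∘(d) W_P`, whose values are
`(d+2 < ⋯ < k+1 < bar(d+1) < ⋯ < bar 2)` (for `d = k` the first range is empty).
Here `id_Y` is the minimal length representative with values `(2 < 3 < ⋯ < k+1)`. -/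
theorem statement9 (n k : ℕ) (hn : 1 ≤ n) (hk : 1 ≤ k) (hk' : k < n+1)
    (d : ℕ) (hd : 1 ≤ d) (hdk : d ≤ k)
    (u0 : Equiv.Perm (Fin (2*n+2))) (hu0 : isMinRep n k u0) (hu0odd : isOdd n u0)
    (hu0val : valSet n k u0 = (Finset.Icc 2 (k+1)).image (fun i => fn n (i-1)))
    (vd : Equiv.Perm (Fin (2*n+2))) (hvd : isMinRep n k vd)
    (hvdc : cosetEq n k vd (mulOcirc n k u0 d)) :
    (isOdd n vd ∧ vd (fn n 0) ≠ fn n 0 ∧ ChainO n k u0 vd d) ∧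
    (∀ u, isMinRep n k u → isOdd n u → u (fn n 0) ≠ fn n 0 →
      ChainO n k u0 u d → bruhatLE n u vd) ∧
    valSet n k vd =
      ((Finset.Icc (d+2) (k+1)).image (fun i => fn n (i-1))) ∪
      ((Finset.Icc 2 (d+1)).image (fun i => fn n (2*n+2-i))) := by
  have hkn : k ≤ n := by omega
  have hval0 : valSet n k u0 = targetSet n k 0 := by
    rw [hu0val, targetSet]
    simp
  have hvald : valSet n k vd = targetSet n k d :=
    (valSet_eq_of_cosetEq hkn hvdc).trans
      (((hu0.hasWindow hkn hval0).mulOcirc hdk hkn).valSet_eq hdk hkn)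
  refine ⟨⟨hvd.isOdd_of_valSet hdk hkn hvald, fun h0 => ?_, ?_⟩, fun u hu hodd h0 hch => ?_, hvald⟩
  · have hmem := apply_mem_valSet vd (x := fn n 0) (k := k) (by rw [fn_val (by omega)]; omega)
    rw [h0, hvald, mem_targetSet hdk hkn, fn_val (by omega)] at hmem
    omega
  · obtain ⟨e, rfl⟩ := Nat.exists_eq_add_of_le' hd
    obtain ⟨v, hv, hval, hch⟩ :=
      exists_chainO_targetSet (Nat.le_of_succ_le hdk) hkn hu0 hval0
    exact hch.snoc_targetSet hdk hkn hv.1 hval hvd hvald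
  · exact hu.bruhatLE_of_isAdmissible hdk hkn (hch.isAdmissible hkn hval0 hu hodd h0) hvd.1 hvald

end
end OddSymplectic
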